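/- arXiv:1711.00948 — 4 statements merged into one kernel-verified Lean document; each statement's English description precedes it below -/
import Mathlib

section
/- For every K ≥ 1 there exists C > 0 depending only on K with the following property. Assume f : ℝ³ × ℝ × ℝ³ → ℝ is of class C² with f ≥ 1/K everywhere and with |f| and all partial derivatives of f up to order 2 bounded by K; u : ℝ³ → ℝ is C^∞ on B₁₀ with σ₂(D²u(x)) = f(x, u(x), Du(x)) and Δu(x) > 0 on B₁₀; and |u(x)| + |Du(x)| ≤ K on B₁₀. Fix y₀ ∈ B₁, set F(x) := f(x, u(x), Du(x)), r(x) := (F(x)·|x−y₀|² + |Du(x)−Du(y₀)|²)^{1/2}, and 𝔅_ρ := {x ∈ B₁₀ : r(x) ≤ ρ}. Then for all δ, R with 0 < δ ≤ R ≤ 9/√K: δ^{−3} ∫_{𝔅_δ} Δu·(F·Δu − det D²u) dx ≤ C · R^{−3} ∫_{𝔅_R} Δu·(F·Δu − det D²u) dx. -/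
open Metric MeasureTheory Real

noncomputable section

abbrev E3 : Type := EuclideanSpace ℝ (Fin 3)

/-- The `i`-th partial derivative of `u`. -/
def pd (i : Fin 3) (u : E3 → ℝ) : E3 → ℝ :=
  fun x => fderiv ℝ u x (EuclideanSpace.single i 1)

/-- The gradient `Du` of `u` as a vector in `ℝ³`. -/
def grad (u : E3 → ℝ) (x : E3) : E3 :=
  (WithLp.equiv 2 (Fin 3 → ℝ)).symm (fun i => pd i u x)

/-- The Hessian matrix `D²u`. -/
def hess (u : E3 → ℝ) (x : E3) : Matrix (Fin 3) (Fin 3) ℝ :=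
  Matrix.of fun i j => pd i (pd j u) x

/-- The Laplacian `Δu`. -/
def lap (u : E3 → ℝ) (x : E3) : ℝ := ∑ i, hess u x i i

def sigma1 (A : Matrix (Fin 3) (Fin 3) ℝ) : ℝ := A.trace

def sigma2 (A : Matrix (Fin 3) (Fin 3) ℝ) : ℝ := (A.trace ^ 2 - (A * A).trace) / 2

def sigma3 (A : Matrix (Fin 3) (Fin 3) ℝ) : ℝ := A.det

/-- The matrix `σ₂^{ij}(x) = Δu(x) δ_{ij} - ∂_i∂_j u(x)`. -/
def sg (u : E3 → ℝ) (x : E3) : Matrix (Fin 3) (Fin 3) ℝ :=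
  lap u x • (1 : Matrix (Fin 3) (Fin 3) ℝ) - hess u x

/-- `f_{u_p}`: the partial derivative of `f` in its `p`-th gradient variable,
evaluated at `(x, u(x), Du(x))`. -/
def fp (f : E3 × ℝ × E3 → ℝ) (u : E3 → ℝ) (p : Fin 3) (x : E3) : ℝ :=
  fderiv ℝ f (x, u x, grad u x) (0, 0, EuclideanSpace.single p 1)

/-- The standing hypotheses: `f` is `C²`, bounded below by `1/K`, with `|f|` and all
derivatives up to order 2 bounded by `K`; `u` is smooth on `B₁₀`, solves
`σ₂(D²u) = f(x,u,Du)` with `Δu > 0` on `B₁₀`, and `|u| + |Du| ≤ K` on `B₁₀`. -/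
def Hyp (K : ℝ) (f : E3 × ℝ × E3 → ℝ) (u : E3 → ℝ) : Prop :=
  ContDiff ℝ 2 f ∧
  (∀ z, 1 / K ≤ f z) ∧
  (∀ z, ∀ k : ℕ, k ≤ 2 → ‖iteratedFDeriv ℝ k f z‖ ≤ K) ∧
  ContDiffOn ℝ (⊤ : ℕ∞) u (ball (0 : E3) 10) ∧
  (∀ x ∈ ball (0 : E3) 10, sigma2 (hess u x) = f (x, u x, grad u x)) ∧
  (∀ x ∈ ball (0 : E3) 10, 0 < lap u x) ∧
  (∀ x ∈ ball (0 : E3) 10, |u x| + ‖grad u x‖ ≤ K)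


/-- the quadratic form -/
def SS (A : Matrix (Fin 3) (Fin 3) ℝ) (i j : Fin 3) : ℝ :=
  A.trace * (if i = j then 1 else 0) - A i j

def SQ (A : Matrix (Fin 3) (Fin 3) ℝ) (v w : Fin 3 → ℝ) : ℝ := ∑ i, ∑ j, SS A i j * v i * w j

def WW (A : Matrix (Fin 3) (Fin 3) ℝ) : ℝ := sigma2 A * A.trace - A.det

lemma trace3 (A : Matrix (Fin 3) (Fin 3) ℝ) : A.trace = A 0 0 + A 1 1 + A 2 2 := by
  simp [Matrix.trace, Fin.sum_univ_three]

lemma sigma2_frob (A : Matrix (Fin 3) (Fin 3) ℝ) (hA : ∀ i j, A i j = A j i) :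
    A.trace ^ 2 = 2 * sigma2 A + ∑ i, ∑ j, A i j ^ 2 := by
  simp only [sigma2, trace3, Matrix.mul_apply, Fin.sum_univ_three]
  rw [hA 1 0, hA 2 0, hA 2 1]; ring

lemma SQ_comm (A : Matrix (Fin 3) (Fin 3) ℝ) (hA : ∀ i j, A i j = A j i) (v w) :
    SQ A v w = SQ A w v := by
  simp only [SQ, SS, trace3, Fin.sum_univ_three, Fin.isValue]
  rw [hA 1 0, hA 2 0, hA 2 1]; simp; ring

lemma SQ_eq (A : Matrix (Fin 3) (Fin 3) ℝ) (v w : Fin 3 → ℝ) :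
    SQ A v w = A.trace * ∑ i, v i * w i - ∑ i, ∑ j, A i j * (v i * w j) := by
  simp only [SQ, SS, trace3, Fin.sum_univ_three, Fin.isValue]
  simp; ring

lemma quad_le (A : Matrix (Fin 3) (Fin 3) ℝ) (hA : ∀ i j, A i j = A j i)
    (h2 : 0 ≤ sigma2 A) (h1 : 0 < A.trace) (v : Fin 3 → ℝ) :
    |∑ i, ∑ j, A i j * (v i * v j)| ≤ A.trace * ∑ i, v i * v i := by
  have h := Finset.sum_mul_sq_le_sq_mul_sq (Finset.univ : Finset (Fin 3 × Fin 3))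
    (fun p => A p.1 p.2) (fun p => v p.1 * v p.2)
  simp only [Fintype.sum_prod_type] at h
  have hf := sigma2_frob A hA
  have e : ∑ i, ∑ j, (v i * v j) ^ 2 = (∑ i, v i * v i) ^ 2 := by
    simp only [Fin.sum_univ_three]; ring
  rw [e] at h
  have n : 0 ≤ ∑ i, v i * v i := Finset.sum_nonneg fun i _ => mul_self_nonneg _
  apply abs_le_of_sq_le_sq _ (mul_nonneg h1.le n)
  rw [mul_pow]
  refine h.trans ?_
  gcongr
  linarith

lemma SQ_nonneg (A : Matrix (Fin 3) (Fin 3) ℝ) (hA : ∀ i j, A i j = A j i)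
    (h2 : 0 ≤ sigma2 A) (h1 : 0 < A.trace) (v : Fin 3 → ℝ) : 0 ≤ SQ A v v := by
  rw [SQ_eq]; have := abs_le.1 (quad_le A hA h2 h1 v); linarith [this.2]

lemma SQ_le (A : Matrix (Fin 3) (Fin 3) ℝ) (hA : ∀ i j, A i j = A j i)
    (h2 : 0 ≤ sigma2 A) (h1 : 0 < A.trace) (v : Fin 3 → ℝ) :
    SQ A v v ≤ 2 * A.trace * ∑ i, v i * v i := by
  rw [SQ_eq]; have := abs_le.1 (quad_le A hA h2 h1 v); linarith [this.1]

lemma SQ_lin (A : Matrix (Fin 3) (Fin 3) ℝ) (hA : ∀ i j, A i j = A j i) (v w : Fin 3 → ℝ) (t : ℝ) :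
    SQ A (fun i => v i + t * w i) (fun i => v i + t * w i) =
      SQ A v v + 2 * t * SQ A v w + t ^ 2 * SQ A w w := by
  simp only [SQ, SS, Fin.sum_univ_three]
  rw [hA 1 0, hA 2 0, hA 2 1]; simp; ring

lemma SQ_cs (A : Matrix (Fin 3) (Fin 3) ℝ) (hA : ∀ i j, A i j = A j i)
    (h2 : 0 ≤ sigma2 A) (h1 : 0 < A.trace) (v w : Fin 3 → ℝ) :
    SQ A v w ^ 2 ≤ SQ A v v * SQ A w w := by
  have := discrim_le_zero (a := SQ A w w) (b := 2 * SQ A v w) (c := SQ A v v) (fun t => by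
    have := SQ_nonneg A hA h2 h1 (fun i => v i + t * w i)
    rw [SQ_lin A hA] at this
    linarith)
  unfold discrim at this; nlinarith

/-- third-order identity, row form -/
lemma W_trace (A : Matrix (Fin 3) (Fin 3) ℝ) (hA : ∀ i j, A i j = A j i) :
    2 * sigma2 A * A.trace + ∑ k, SQ A (A k) (A k) = 3 * WW A := by
  simp only [SQ, SS, WW, sigma2, Matrix.det_fin_three, trace3, Matrix.mul_apply, Fin.sum_univ_three,
    Fin.isValue]
  rw [hA 1 0, hA 2 0, hA 2 1]; simp; ring

lemma SQ_key (A : Matrix (Fin 3) (Fin 3) ℝ) (hA : ∀ i j, A i j = A j i) (a w : Fin 3 → ℝ) :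
    WW A * (sigma2 A * ∑ i, a i * a i + ∑ i, w i * w i) -
      SQ A (fun i => sigma2 A * a i + ∑ k, w k * A i k) (fun i => sigma2 A * a i + ∑ k, w k * A i k)
    = sigma2 A * SQ A (fun i => (∑ k, a k * A i k) - w i) (fun i => (∑ k, a k * A i k) - w i) := by
  simp only [SQ, SS, WW, sigma2, Matrix.det_fin_three, trace3, Matrix.mul_apply, Fin.sum_univ_three,
    Fin.isValue]
  rw [hA 1 0, hA 2 0, hA 2 1]
  generalize A 0 0 = p; generalize A 0 1 = q; generalize A 0 2 = r
  generalize A 1 1 = s; generalize A 1 2 = t; generalize A 2 2 = m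
  generalize a 0 = a0; generalize a 1 = a1; generalize a 2 = a2
  generalize w 0 = w0; generalize w 1 = w1; generalize w 2 = w2
  simp; ring

lemma SQ_xi_le (A : Matrix (Fin 3) (Fin 3) ℝ) (hA : ∀ i j, A i j = A j i)
    (h2 : 0 ≤ sigma2 A) (h1 : 0 < A.trace) (a w : Fin 3 → ℝ) :
    SQ A (fun i => sigma2 A * a i + ∑ k, w k * A i k) (fun i => sigma2 A * a i + ∑ k, w k * A i k)
      ≤ WW A * (sigma2 A * ∑ i, a i * a i + ∑ i, w i * w i) := by
  have := SQ_key A hA a w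
  have h := mul_nonneg h2 (SQ_nonneg A hA h2 h1 (fun i => (∑ k, a k * A i k) - w i))
  linarith

lemma WW_ge (A : Matrix (Fin 3) (Fin 3) ℝ) (hA : ∀ i j, A i j = A j i)
    (h2 : 0 ≤ sigma2 A) (h1 : 0 < A.trace) : 2 * sigma2 A * A.trace ≤ 3 * WW A := by
  have := W_trace A hA
  have h : 0 ≤ ∑ k, SQ A (A k) (A k) := Finset.sum_nonneg fun k _ => SQ_nonneg A hA h2 h1 _
  linarith

lemma SS_factor (A : Matrix (Fin 3) (Fin 3) ℝ) (hA : ∀ i j, A i j = A j i)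
    (h2 : 0 ≤ sigma2 A) (h1 : 0 < A.trace) :
    ∃ (m : ℕ) (B : Fin m → Fin 3 → ℝ), ∀ i j, SS A i j = ∑ k, B k i * B k j := by
  have hp : (Matrix.of (SS A)).PosSemidef := by
    rw [Matrix.posSemidef_iff_dotProduct_mulVec]
    refine ⟨?_, fun x => ?_⟩
    · ext i j; simp [SS, hA i j, eq_comm]
    · have := SQ_nonneg A hA h2 h1 x
      have e : star x ⬝ᵥ (Matrix.of (SS A)).mulVec x = SQ A x x := by
        simp only [SQ, dotProduct, Matrix.mulVec, Fin.sum_univ_three, Matrix.of_apply, Pi.star_apply, star_trivial]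
        ring
      rw [e]; exact this
  obtain ⟨m, B, hB⟩ := Matrix.posSemidef_iff_eq_sum_vecMulVec.1 hp
  refine ⟨m, B, fun i j => ?_⟩
  have := congrFun (congrFun hB i) j
  simpa [Matrix.sum_apply, Matrix.vecMulVec_apply] using this

/-- reverse Cauchy-Schwarz -/
lemma concav (A M : Matrix (Fin 3) (Fin 3) ℝ) (hA : ∀ i j, A i j = A j i)
    (h2 : 0 < sigma2 A) (h1 : 0 < A.trace) :
    2 * sigma2 A * (M.trace ^ 2 - ∑ i, ∑ j, M i j ^ 2) ≤ (∑ i, ∑ j, SS A i j * M i j) ^ 2 := by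
  set X := ∑ i, ∑ j, SS A i j * M i j with hX
  have eX : X = A.trace * M.trace - ∑ i, ∑ j, A i j * M i j := by
    simp only [hX, SS, trace3, Fin.sum_univ_three, Fin.isValue]; simp; ring
  obtain ⟨c, hc⟩ : ∃ c, M.trace = c * A.trace := ⟨M.trace / A.trace, by field_simp⟩
  have hn : 0 ≤ ∑ i, ∑ j, (M i j - c * A i j) ^ 2 := by positivity
  have he : ∑ i, ∑ j, (M i j - c * A i j) ^ 2 = (∑ i, ∑ j, M i j ^ 2)
      - 2 * c * (∑ i, ∑ j, A i j * M i j) + c ^ 2 * ∑ i, ∑ j, A i j ^ 2 := by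
    simp only [Fin.sum_univ_three]; ring
  have hf := sigma2_frob A hA
  rw [he] at hn
  have h3 : M.trace ^ 2 - ∑ i, ∑ j, M i j ^ 2 ≤ 2 * c * X - 2 * c ^ 2 * sigma2 A := by
    have e2 : ∑ i, ∑ j, A i j * M i j = A.trace * M.trace - X := by rw [eX]; ring
    have e3 : ∑ i, ∑ j, A i j ^ 2 = A.trace ^ 2 - 2 * sigma2 A := by linarith
    rw [e2, e3, hc] at hn
    rw [hc]
    linarith
  have := mul_le_mul_of_nonneg_left h3 (by positivity : 0 ≤ 2 * sigma2 A)
  nlinarith [sq_nonneg (X - 2 * c * sigma2 A)]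


def zv (p : Fin 3 → ℝ) (A : Matrix (Fin 3) (Fin 3) ℝ) (i : Fin 3) : E3 × ℝ × E3 :=
  (EuclideanSpace.single i 1, p i, WithLp.toLp 2 (A i))

structure PW (K : ℝ) (p : Fin 3 → ℝ) (A : Matrix (Fin 3) (Fin 3) ℝ) : Prop where
  hK : 1 ≤ K
  hA : ∀ i j, A i j = A j i
  lo : 1 / K ≤ sigma2 A
  hi : sigma2 A ≤ K
  h1 : 0 < A.trace
  hp : ∑ i, p i * p i ≤ K ^ 2

namespace PW
variable {K : ℝ} {p : Fin 3 → ℝ} {A : Matrix (Fin 3) (Fin 3) ℝ}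

lemma K0 (h : PW K p A) : 0 < K := by linarith [h.hK]
lemma s2 (h : PW K p A) : 0 < sigma2 A := lt_of_lt_of_le (by have := h.K0; positivity) h.lo

lemma one_le (h : PW K p A) : 1 ≤ K * A.trace := by
  have h0 := h.K0
  have hf := sigma2_frob A h.hA
  have : 0 ≤ ∑ i, ∑ j, A i j ^ 2 := by positivity
  have h2 : 2 / K ≤ A.trace ^ 2 := by
    have := h.lo
    have e : 2 / K = 2 * (1 / K) := by ring
    rw [e]; linarith
  have h3 : 1 ≤ (K * A.trace) ^ 2 := by
    have : K ^ 2 * (2 / K) ≤ K ^ 2 * A.trace ^ 2 := by gcongr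
    have e : K ^ 2 * (2 / K) = 2 * K := by field_simp
    rw [e] at this; rw [mul_pow]; linarith [h.hK]
  have := mul_pos h0 h.h1
  nlinarith

lemma b_le (h : PW K p A) : A.trace ≤ 3 / 2 * K * WW A := by
  have h0 := h.K0
  have hw := WW_ge A h.hA h.s2.le h.h1
  have : 2 * (1 / K) * A.trace ≤ 2 * sigma2 A * A.trace := by
    have := h.lo; have := h.h1; gcongr
  have h3 : K * (2 * (1 / K) * A.trace) ≤ K * (3 * WW A) :=
    mul_le_mul_of_nonneg_left (by linarith) h0.le
  have e : K * (2 * (1 / K) * A.trace) = 2 * A.trace := by field_simp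
  linarith

lemma W_pos (h : PW K p A) : 0 < WW A := by
  have := h.b_le; have := h.h1; have := h.K0
  by_contra hn
  push Not at hn
  have : 3 / 2 * K * WW A ≤ 0 := mul_nonpos_of_nonneg_of_nonpos (by positivity) hn
  linarith

lemma one_le_W (h : PW K p A) : 1 ≤ 3 / 2 * K ^ 2 * WW A := by
  have h1 := h.one_le
  have := mul_le_mul_of_nonneg_left h.b_le h.K0.le
  linarith

lemma frob_le (h : PW K p A) : ∑ i, ∑ j, A i j ^ 2 ≤ A.trace ^ 2 := by
  have hf := sigma2_frob A h.hA
  linarith [h.s2]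

lemma row_sq (h : PW K p A) (i : Fin 3) : ∑ j, A i j ^ 2 ≤ A.trace ^ 2 := by
  refine le_trans ?_ h.frob_le
  exact Finset.single_le_sum (f := fun i => ∑ j, A i j ^ 2)
    (fun i _ => Finset.sum_nonneg fun j _ => sq_nonneg _) (Finset.mem_univ i)

lemma entry (h : PW K p A) (i j : Fin 3) : |A i j| ≤ A.trace := by
  refine abs_le_of_sq_le_sq ?_ h.h1.le
  refine le_trans ?_ (h.row_sq i)
  exact Finset.single_le_sum (f := fun j => A i j ^ 2)
    (fun j _ => sq_nonneg _) (Finset.mem_univ j)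

lemma p_le (h : PW K p A) (i : Fin 3) : |p i| ≤ K := by
  refine abs_le_of_sq_le_sq ?_ h.K0.le
  refine le_trans ?_ h.hp
  rw [sq]
  exact Finset.single_le_sum (f := fun j => p j * p j)
    (fun j _ => mul_self_nonneg _) (Finset.mem_univ i)

lemma norm_row (h : PW K p A) (i : Fin 3) : ‖(WithLp.toLp 2 (A i) : E3)‖ ≤ A.trace := by
  rw [EuclideanSpace.norm_eq]
  apply Real.sqrt_le_iff.2 ⟨h.h1.le, ?_⟩
  simpa using h.row_sq i

lemma norm_z (h : PW K p A) (i : Fin 3) : ‖zv p A i‖ ≤ K ^ 2 * A.trace := by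
  have h1 := h.one_le
  have hK := h.hK
  have hb := h.h1
  have hKK : 1 ≤ K ^ 2 := by nlinarith
  have a1 : (1 : ℝ) ≤ K ^ 2 * A.trace := by nlinarith
  have a2 : K ≤ K ^ 2 * A.trace := by nlinarith
  have a3 : A.trace ≤ K ^ 2 * A.trace := by nlinarith
  simp only [zv, Prod.norm_def, sup_le_iff]
  refine ⟨?_, ?_, ?_⟩
  · simpa using a1
  · exact (h.p_le i).trans a2
  · exact (h.norm_row i).trans a3

lemma sum_zv (h : PW K p A) (β : Fin 3 → ℝ) : ‖∑ i, β i • zv p A i‖ ^ 2 ≤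
    ∑ i, β i * β i + (∑ i, β i * p i) ^ 2 + ∑ k, (∑ i, β i * A k i) ^ 2 := by
  have e : ∑ i, β i • zv p A i = ((WithLp.toLp 2 β : E3), ∑ i, β i * p i,
      (WithLp.toLp 2 (fun k => ∑ i, β i * A k i) : E3)) := by
    refine Prod.ext ?_ (Prod.ext ?_ ?_)
    · simp only [zv, Prod.fst_sum, Prod.smul_fst]
      ext k; simp [Pi.single_apply]
    · simp [zv, Prod.snd_sum, Prod.fst_sum]
    · simp only [zv, Prod.snd_sum, Prod.smul_snd]
      ext k; simp [h.hA k]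
  rw [e]
  have n1 : 0 ≤ ∑ i, β i * β i := Finset.sum_nonneg fun i _ => mul_self_nonneg _
  have n2 : 0 ≤ (∑ i, β i * p i) ^ 2 := sq_nonneg _
  have n3 : 0 ≤ ∑ k, (∑ i, β i * A k i) ^ 2 := Finset.sum_nonneg fun i _ => sq_nonneg _
  rw [← Real.le_sqrt (norm_nonneg _) (by positivity)]
  simp only [Prod.norm_def, sup_le_iff]
  refine ⟨?_, ?_, ?_⟩
  · rw [EuclideanSpace.norm_eq]; apply Real.sqrt_le_sqrt
    have : ∑ i, ‖(WithLp.toLp 2 β : E3) i‖ ^ 2 = ∑ i, β i * β i := by simp [sq]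
    rw [this]; linarith
  · rw [Real.norm_eq_abs]; apply Real.abs_le_sqrt; linarith
  · rw [EuclideanSpace.norm_eq]; apply Real.sqrt_le_sqrt
    simp only [Real.norm_eq_abs, sq_abs]; linarith

lemma trS : ∑ i, SS A i i = 2 * A.trace := by
  simp [SS, Fin.sum_univ_three, trace3]; ring

lemma B1 (h : PW K p A) (D : (E3 × ℝ × E3) →L[ℝ] (E3 × ℝ × E3) →L[ℝ] ℝ) {c : ℝ} (hD : ‖D‖ ≤ c) :
    |∑ i, ∑ j, SS A i j * D (zv p A i) (zv p A j)| ≤ 9 * c * K ^ 3 * WW A := by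
  obtain ⟨m, B, hB⟩ := SS_factor A h.hA h.s2.le h.h1
  have hc : 0 ≤ c := le_trans (norm_nonneg D) hD
  set Z : Fin m → E3 × ℝ × E3 := fun k => ∑ i, B k i • zv p A i with hZ
  have e : ∑ i, ∑ j, SS A i j * D (zv p A i) (zv p A j) = ∑ k, D (Z k) (Z k) := by
    simp only [hB, hZ, map_add, add_apply, map_smul,
      smul_apply, smul_eq_mul, Fin.sum_univ_three, Finset.sum_mul]
    simp only [← Finset.sum_add_distrib]
    refine Finset.sum_congr rfl fun k _ => ?_
    ring
  have e2 : ∑ k, (∑ i, B k i * B k i + (∑ i, B k i * p i) ^ 2 + ∑ l, (∑ i, B k i * A l i) ^ 2)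
      = 2 * A.trace + SQ A p p + ∑ l, SQ A (A l) (A l) := by
    rw [← PW.trS]
    simp only [SQ, hB, Fin.sum_univ_three, Finset.sum_mul]
    simp only [← Finset.sum_add_distrib]
    refine Finset.sum_congr rfl fun k _ => ?_
    ring
  rw [e]
  calc |∑ k, D (Z k) (Z k)| ≤ ∑ k, |D (Z k) (Z k)| := Finset.abs_sum_le_sum_abs _ _
    _ ≤ ∑ k, c * (∑ i, B k i * B k i + (∑ i, B k i * p i) ^ 2
          + ∑ l, (∑ i, B k i * A l i) ^ 2) := by
        refine Finset.sum_le_sum fun k _ => ?_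
        have h1 := D.le_opNorm₂ (Z k) (Z k)
        rw [Real.norm_eq_abs] at h1
        have h2 := h.sum_zv (B k)
        calc _ ≤ ‖D‖ * ‖Z k‖ * ‖Z k‖ := h1
          _ = ‖D‖ * ‖Z k‖ ^ 2 := by ring
          _ ≤ _ := by gcongr
    _ = c * (2 * A.trace + SQ A p p + ∑ l, SQ A (A l) (A l)) := by rw [← e2, Finset.mul_sum]
    _ ≤ c * (9 * K ^ 3 * WW A) := by
        gcongr
        have q1 := SQ_le A h.hA h.s2.le h.h1 p
        have q2 := W_trace A h.hA
        have q3 : 2 * A.trace * ∑ i, p i * p i ≤ 2 * A.trace * K ^ 2 := by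
          have := h.h1; have := h.hp; gcongr
        have q4 : 0 ≤ 2 * sigma2 A * A.trace := by have := h.s2; have := h.h1; positivity
        have q5 := h.b_le
        have hK := h.hK
        have hW := h.W_pos
        have q6 : 2 * A.trace * (1 + K ^ 2) ≤ 2 * (3 / 2 * K * WW A) * (1 + K ^ 2) := by gcongr
        have q7 : K ≤ K ^ 3 := by nlinarith
        have q8 : 1 ≤ K ^ 3 := by nlinarith
        have q9 : 3 * K * WW A ≤ 3 * K ^ 3 * WW A := by gcongr
        have q10 : 3 * 1 * WW A ≤ 3 * K ^ 3 * WW A := by gcongr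
        nlinarith
    _ = _ := by ring

lemma B2 (h : PW K p A) (L : (E3 × ℝ × E3) →L[ℝ] ℝ) {c : ℝ} (hL : ‖L‖ ≤ c) :
    SQ A (fun i => L (zv p A i)) (fun i => L (zv p A i)) ≤ 9 * c ^ 2 * K ^ 3 * WW A := by
  have hD : ‖(ContinuousLinearMap.smulRight L L)‖ ≤ c ^ 2 := by
    rw [ContinuousLinearMap.norm_smulRight_apply, sq]
    gcongr
    exact (norm_nonneg _).trans hL
  have := (abs_le.1 (h.B1 _ hD)).2
  simpa [SQ, mul_assoc] using this
end PW


/-- pointwise data -/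
structure PD (K : ℝ) (p : Fin 3 → ℝ) (A : Matrix (Fin 3) (Fin 3) ℝ)
    (L : (E3 × ℝ × E3) →L[ℝ] ℝ) (D : (E3 × ℝ × E3) →L[ℝ] (E3 × ℝ × E3) →L[ℝ] ℝ)
    (T : Fin 3 → Fin 3 → Fin 3 → ℝ) (a w : Fin 3 → ℝ) (r : ℝ) : Prop where
  pw : PW K p A
  hL : ‖L‖ ≤ K
  hD : ‖D‖ ≤ K
  hT : ∀ k, ∑ i, ∑ j, SS A i j * T k i j = L (zv p A k)
  r0 : 0 ≤ r
  r1 : r ≤ 1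
  hr : r ^ 2 = sigma2 A * ∑ i, a i * a i + ∑ i, w i * w i

namespace PD
variable {K : ℝ} {p : Fin 3 → ℝ} {A : Matrix (Fin 3) (Fin 3) ℝ}
    {L : (E3 × ℝ × E3) →L[ℝ] ℝ} {D : (E3 × ℝ × E3) →L[ℝ] (E3 × ℝ × E3) →L[ℝ] ℝ}
    {T : Fin 3 → Fin 3 → Fin 3 → ℝ} {a w : Fin 3 → ℝ} {r : ℝ}

lemma Fd (h : PD K p A L D T a w r) (i : Fin 3) : |L (zv p A i)| ≤ K ^ 3 * A.trace := by
  have h1 := L.le_opNorm (zv p A i)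
  have h2 := h.pw.norm_z i
  have hL := h.hL
  have hK := h.pw.K0
  calc |L (zv p A i)| ≤ ‖L‖ * ‖zv p A i‖ := h1
    _ ≤ K * (K ^ 2 * A.trace) := by gcongr
    _ = _ := by ring

lemma rho_le (h : PD K p A L D T a w r) : ∑ i, a i * a i ≤ K * r ^ 2 := by
  have hK := h.pw.K0
  have n1 : 0 ≤ ∑ i, a i * a i := Finset.sum_nonneg fun i _ => mul_self_nonneg _
  have n2 : 0 ≤ ∑ i, w i * w i := Finset.sum_nonneg fun i _ => mul_self_nonneg _
  have h1 : 1 / K * ∑ i, a i * a i ≤ sigma2 A * ∑ i, a i * a i := by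
    have := h.pw.lo; gcongr
  have h2 : K * (1 / K * ∑ i, a i * a i) ≤ K * r ^ 2 :=
    mul_le_mul_of_nonneg_left (by linarith [h.hr]) hK.le
  have e : K * (1 / K * ∑ i, a i * a i) = ∑ i, a i * a i := by field_simp
  linarith

lemma w_le (h : PD K p A L D T a w r) : ∑ i, w i * w i ≤ r ^ 2 := by
  have n1 : 0 ≤ ∑ i, a i * a i := Finset.sum_nonneg fun i _ => mul_self_nonneg _
  have := mul_nonneg h.pw.s2.le n1
  linarith [h.hr]

lemma wi_le (h : PD K p A L D T a w r) (i : Fin 3) : |w i| ≤ r := by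
  apply abs_le_of_sq_le_sq _ h.r0
  refine le_trans ?_ h.w_le
  rw [sq]
  exact Finset.single_le_sum (f := fun j => w j * w j)
    (fun j _ => mul_self_nonneg _) (Finset.mem_univ i)

lemma ai_le (h : PD K p A L D T a w r) (i : Fin 3) : |a i| ≤ K * r := by
  apply abs_le_of_sq_le_sq _ (mul_nonneg h.pw.K0.le h.r0)
  have h1 : a i ^ 2 ≤ K * r ^ 2 := by
    refine le_trans ?_ h.rho_le
    rw [sq]
    exact Finset.single_le_sum (f := fun j => a j * a j)
      (fun j _ => mul_self_nonneg _) (Finset.mem_univ i)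
  have := h.pw.hK
  nlinarith [sq_nonneg r, mul_nonneg (mul_nonneg h.pw.K0.le (sub_nonneg.2 this)) (sq_nonneg r)]

lemma SA (A : Matrix (Fin 3) (Fin 3) ℝ) (hA : ∀ i j, A i j = A j i) :
    ∑ i, ∑ j, SS A i j * A i j = 2 * sigma2 A := by
  simp only [SS, sigma2, trace3, Matrix.mul_apply, Fin.sum_univ_three, Fin.isValue]
  rw [hA 1 0, hA 2 0, hA 2 1]; simp; ring

lemma norm3 (v : Fin 3 → ℝ) {c : ℝ} (hc : 0 ≤ c) (hv : ∀ i, |v i| ≤ c) :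
    ‖(WithLp.toLp 2 v : E3)‖ ≤ 2 * c := by
  rw [EuclideanSpace.norm_eq]
  apply Real.sqrt_le_iff.2 ⟨by positivity, ?_⟩
  simp only [Fin.sum_univ_three, Real.norm_eq_abs]
  have := hv 0; have := hv 1; have := hv 2
  have : |v 0| ^ 2 ≤ c ^ 2 := by gcongr
  have : |v 1| ^ 2 ≤ c ^ 2 := by gcongr
  have : |v 2| ^ 2 ≤ c ^ 2 := by gcongr
  nlinarith [sq_nonneg c]

lemma SFdd (h : PD K p A L D T a w r) :
    |∑ i, ∑ j, SS A i j * (D (zv p A i) (zv p A j) +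
      L (0, A i j, WithLp.toLp 2 (fun k => T k i j)))| ≤ 12 * K ^ 5 * WW A := by
  have hK := h.pw.hK
  have hW := h.pw.W_pos
  have hb := h.pw.h1
  have e : ∑ i, ∑ j, SS A i j * (D (zv p A i) (zv p A j) +
      L (0, A i j, WithLp.toLp 2 (fun k => T k i j))) =
      ∑ i, ∑ j, SS A i j * (D (zv p A i) (zv p A j)) +
      L (0, 2 * sigma2 A, WithLp.toLp 2 (fun k => L (zv p A k))) := by
    have e2 : ((0, 2 * sigma2 A, WithLp.toLp 2 (fun k => L (zv p A k))) : E3 × ℝ × E3) =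
        ∑ i, ∑ j, SS A i j • (0, A i j, WithLp.toLp 2 (fun k => T k i j)) := by
      refine Prod.ext ?_ (Prod.ext ?_ ?_)
      · simp [Prod.fst_sum]
      · simp only [Prod.snd_sum, Prod.fst_sum, Prod.smul_snd, Prod.smul_fst, smul_eq_mul]
        rw [SA A h.pw.hA]
      · simp only [Prod.snd_sum, Prod.smul_snd]
        ext k; simp [h.hT]
    rw [e2]
    simp only [map_sum, map_smul, smul_eq_mul, mul_add, Finset.sum_add_distrib]
  have b1 := h.pw.B1 D h.hD
  have b2 : |L (0, 2 * sigma2 A, WithLp.toLp 2 (fun k => L (zv p A k)))| ≤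
      K * (2 * (K ^ 3 * A.trace)) := by
    refine (L.le_opNorm _).trans ?_
    have hL := h.hL
    gcongr
    simp only [Prod.norm_def, sup_le_iff]
    refine ⟨by simp; positivity, ?_, norm3 _ (by positivity) h.Fd⟩
    have h1 := h.pw.one_le
    rw [Real.norm_eq_abs, abs_of_pos (by linarith [h.pw.s2])]
    have := h.pw.hi
    have : K ^ 2 * 1 ≤ K ^ 2 * (K * A.trace) := by gcongr
    nlinarith
  have b3 : K * (2 * (K ^ 3 * A.trace)) ≤ K * (2 * (K ^ 3 * (3 / 2 * K * WW A))) := by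
    have := h.pw.b_le; gcongr
  have b4 : 9 * K * K ^ 3 * WW A ≤ 9 * K ^ 5 * WW A := by
    have : K ^ 4 ≤ K ^ 5 := pow_le_pow_right₀ hK (by norm_num)
    have e : 9 * K * K ^ 3 * WW A = 9 * K ^ 4 * WW A := by ring
    rw [e]; gcongr
  rw [e]
  refine (abs_add_le _ _).trans ?_
  linarith [show K * (2 * (K ^ 3 * (3 / 2 * K * WW A))) = 3 * K ^ 5 * WW A by ring]

lemma SFa (h : PD K p A L D T a w r) :
    |SQ A (fun i => L (zv p A i)) a| ≤ 6 * K ^ 4 * r * WW A := by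
  have hK := h.pw.hK
  have hW := h.pw.W_pos
  have hb := h.pw.h1
  have hr := h.r0
  apply abs_le_of_sq_le_sq _ (by positivity)
  have c1 := SQ_cs A h.pw.hA h.pw.s2.le hb (fun i => L (zv p A i)) a
  have c2 := h.pw.B2 L h.hL
  have c3 := SQ_le A h.pw.hA h.pw.s2.le hb a
  have c4 := h.rho_le
  have c5 := h.pw.b_le
  have c0 := SQ_nonneg A h.pw.hA h.pw.s2.le hb a
  calc _ ≤ _ := c1
    _ ≤ (9 * K ^ 2 * K ^ 3 * WW A) * (2 * (3 / 2 * K * WW A) * (K * r ^ 2)) := by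
      have c6 : SQ A a a ≤ 2 * (3 / 2 * K * WW A) * (K * r ^ 2) := by
        refine c3.trans ?_
        gcongr
        exact Finset.sum_nonneg fun i _ => mul_self_nonneg _
      gcongr
    _ = 27 * (K ^ 7 * r ^ 2 * WW A ^ 2) := by ring
    _ ≤ 36 * (K ^ 8 * r ^ 2 * WW A ^ 2) := by
      have : K ^ 7 ≤ K ^ 8 := pow_le_pow_right₀ hK (by norm_num)
      gcongr; norm_num
    _ = _ := by ring

lemma wF (h : PD K p A L D T a w r) :
    |∑ k, w k * L (zv p A k)| ≤ 5 * K ^ 4 * r * WW A := by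
  have hK := h.pw.hK
  have hW := h.pw.W_pos
  have hb := h.pw.h1
  have hr := h.r0
  have key : ∀ k, |w k * L (zv p A k)| ≤ r * (K ^ 3 * (3 / 2 * K * WW A)) := fun k => by
    rw [abs_mul]
    have := h.wi_le k; have := h.Fd k; have := h.pw.b_le
    calc |w k| * |L (zv p A k)| ≤ r * (K ^ 3 * A.trace) := by gcongr
      _ ≤ _ := by gcongr
  refine (Finset.abs_sum_le_sum_abs _ _).trans ?_
  refine (Finset.sum_le_sum fun k _ => key k).trans ?_
  simp
  have : 0 ≤ K ^ 4 * r * WW A := by positivity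
  nlinarith

lemma AA (A : Matrix (Fin 3) (Fin 3) ℝ) (hA : ∀ i j, A i j = A j i) :
    ∑ i, ∑ j, SS A i j * ∑ k, A i k * A j k = ∑ k, SQ A (A k) (A k) := by
  simp only [SQ, Fin.sum_univ_three]
  rw [hA 1 0, hA 2 0, hA 2 1]; ring

lemma P4 (h : PD K p A L D T a w r) :
    (6 - 100 * K ^ 6 * r) * WW A ≤ ∑ i, ∑ j, SS A i j *
      ((D (zv p A i) (zv p A j) + L (0, A i j, WithLp.toLp 2 (fun k => T k i j))) * (∑ i, a i * a i)
       + 2 * L (zv p A i) * a j + 2 * L (zv p A j) * a i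
       + 2 * sigma2 A * (if i = j then 1 else 0)
       + 2 * ∑ k, A i k * A j k + 2 * ∑ k, w k * T k i j) := by
  have hK := h.pw.hK
  have hW := h.pw.W_pos
  have hr := h.r0
  have e : ∑ i, ∑ j, SS A i j *
      ((D (zv p A i) (zv p A j) + L (0, A i j, WithLp.toLp 2 (fun k => T k i j))) * (∑ i, a i * a i)
       + 2 * L (zv p A i) * a j + 2 * L (zv p A j) * a i
       + 2 * sigma2 A * (if i = j then 1 else 0)
       + 2 * ∑ k, A i k * A j k + 2 * ∑ k, w k * T k i j) =
      (∑ i, ∑ j, SS A i j * (D (zv p A i) (zv p A j) +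
        L (0, A i j, WithLp.toLp 2 (fun k => T k i j)))) * (∑ i, a i * a i)
      + 4 * SQ A (fun i => L (zv p A i)) a + 6 * WW A + 2 * ∑ k, w k * L (zv p A k) := by
    have e1 : 6 * WW A = 2 * sigma2 A * ∑ i, SS A i i + 2 * (∑ i, ∑ j, SS A i j * ∑ k, A i k * A j k) := by
      rw [AA A h.pw.hA, PW.trS]; linarith [W_trace A h.pw.hA]
    have e2 : SQ A (fun i => L (zv p A i)) a = SQ A a (fun i => L (zv p A i)) := SQ_comm A h.pw.hA _ _
    have e3 : 4 * SQ A (fun i => L (zv p A i)) a = 2 * SQ A (fun i => L (zv p A i)) a +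
      2 * SQ A a (fun i => L (zv p A i)) := by rw [← e2]; ring
    rw [e1, e3]
    simp only [← h.hT, SQ]
    generalize ∑ i, a i * a i = ρ
    generalize sigma2 A = F
    simp only [Fin.sum_univ_three]
    simp
    ring
  rw [e]
  have b1 := (abs_le.1 h.SFdd).1
  have b2 := (abs_le.1 h.SFa).1
  have b3 := (abs_le.1 h.wF).1
  have n1 : 0 ≤ ∑ i, a i * a i := Finset.sum_nonneg fun i _ => mul_self_nonneg _
  have b4 : -(12 * K ^ 6 * r * WW A) ≤ (∑ i, ∑ j, SS A i j * (D (zv p A i) (zv p A j) +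
        L (0, A i j, WithLp.toLp 2 (fun k => T k i j)))) * (∑ i, a i * a i) := by
    have s1 := mul_le_mul_of_nonneg_right b1 n1
    have s2 : 12 * K ^ 5 * WW A * (∑ i, a i * a i) ≤ 12 * K ^ 5 * WW A * (K * (r * 1)) := by
      have := h.rho_le
      have : K * r ^ 2 ≤ K * (r * 1) := by rw [sq]; have := h.r1; gcongr
      gcongr; linarith
    nlinarith
  have : K ^ 4 ≤ K ^ 6 := pow_le_pow_right₀ hK (by norm_num)
  have b5 : K ^ 4 * (r * WW A) ≤ K ^ 6 * (r * WW A) := by gcongr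
  have b6 : 0 ≤ K ^ 6 * (r * WW A) := by positivity
  nlinarith

lemma P5 (h : PD K p A L D T a w r) :
    SQ A (fun i => L (zv p A i) * (∑ i, a i * a i) + 2 * sigma2 A * a i + 2 * ∑ k, w k * A i k)
      (fun i => L (zv p A i) * (∑ i, a i * a i) + 2 * sigma2 A * a i + 2 * ∑ k, w k * A i k)
      ≤ 4 * r ^ 2 * (1 + 6 * K ^ 7 * r) * WW A := by
  have hK := h.pw.hK
  have hW := h.pw.W_pos
  have hr := h.r0
  have hr1 := h.r1
  have hb := h.pw.h1
  set ρ := ∑ i, a i * a i with hρ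
  set ξ : Fin 3 → ℝ := fun i => sigma2 A * a i + ∑ k, w k * A i k with hξ
  set G : Fin 3 → ℝ := fun i => L (zv p A i) with hG
  have e : (fun i => L (zv p A i) * ρ + 2 * sigma2 A * a i + 2 * ∑ k, w k * A i k) =
      fun i => (2 * ξ i) + ρ * G i := by ext i; simp only [hξ, hG]; ring
  rw [e, SQ_lin A h.pw.hA]
  have e2 : SQ A (fun i => 2 * ξ i) (fun i => 2 * ξ i) = 4 * SQ A ξ ξ := by
    simp only [SQ, Fin.sum_univ_three]; ring
  have e3 : SQ A (fun i => 2 * ξ i) G = 2 * SQ A ξ G := by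
    simp only [SQ, Fin.sum_univ_three]; ring
  rw [e2, e3]
  have x1 : SQ A ξ ξ ≤ WW A * r ^ 2 := by
    have := SQ_xi_le A h.pw.hA h.pw.s2.le hb a w
    rw [h.hr]; exact this
  have x2 := h.pw.B2 L h.hL
  have x0 := SQ_nonneg A h.pw.hA h.pw.s2.le hb G
  have x3 : |SQ A ξ G| ≤ 3 * K ^ 3 * r * WW A := by
    apply abs_le_of_sq_le_sq _ (by positivity)
    refine (SQ_cs A h.pw.hA h.pw.s2.le hb ξ G).trans ?_
    calc _ ≤ (WW A * r ^ 2) * (9 * K ^ 2 * K ^ 3 * WW A) := by gcongr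
      _ = 9 * (K ^ 5 * r ^ 2 * WW A ^ 2) := by ring
      _ ≤ 9 * (K ^ 6 * r ^ 2 * WW A ^ 2) := by
        have : K ^ 5 ≤ K ^ 6 := pow_le_pow_right₀ hK (by norm_num)
        gcongr
      _ = _ := by ring
  have n1 : 0 ≤ ρ := Finset.sum_nonneg fun i _ => mul_self_nonneg _
  have x4 : ρ ≤ K * r ^ 2 := h.rho_le
  have y1 : ρ * SQ A ξ G ≤ (K * r ^ 2) * (3 * K ^ 3 * r * WW A) := by
    have := (abs_le.1 x3).2
    have := mul_le_mul_of_nonneg_left this n1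
    refine this.trans ?_
    gcongr
  have y2 : ρ ^ 2 * SQ A G G ≤ (K * r ^ 2) ^ 2 * (9 * K ^ 2 * K ^ 3 * WW A) := by gcongr
  have y3 : (K * r ^ 2) * (3 * K ^ 3 * r * WW A) ≤ 3 * (K ^ 7 * r ^ 3 * WW A) := by
    have : K ^ 4 ≤ K ^ 7 := pow_le_pow_right₀ hK (by norm_num)
    calc _ = 3 * (K ^ 4 * r ^ 3 * WW A) := by ring
      _ ≤ _ := by gcongr
  have y4 : (K * r ^ 2) ^ 2 * (9 * K ^ 2 * K ^ 3 * WW A) ≤ 9 * (K ^ 7 * r ^ 3 * WW A) := by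
    calc _ = 9 * (K ^ 7 * (r ^ 3 * r) * WW A) := by ring
      _ ≤ 9 * (K ^ 7 * (r ^ 3 * 1) * WW A) := by gcongr
      _ = _ := by ring
  have : 0 ≤ K ^ 7 * r ^ 3 * WW A := by positivity
  nlinarith

lemma P3 (h : PD K p A L D T a w r) (g : Fin 3 → ℝ) (hg : ∀ i, |g i| ≤ K) :
    |∑ i, g i * (L (zv p A i) * (∑ i, a i * a i) + 2 * sigma2 A * a i + 2 * ∑ k, w k * A i k)|
      ≤ 41 * K ^ 6 * r * WW A := by
  have hK := h.pw.hK
  have hW := h.pw.W_pos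
  have hr := h.r0
  have hr1 := h.r1
  have hb := h.pw.h1
  have n1 : 0 ≤ ∑ i, a i * a i := Finset.sum_nonneg fun i _ => mul_self_nonneg _
  have key : ∀ i, |g i * (L (zv p A i) * (∑ i, a i * a i) + 2 * sigma2 A * a i
      + 2 * ∑ k, w k * A i k)| ≤ K * (9 * K ^ 4 * r * A.trace) := fun i => by
    rw [abs_mul]
    have := hg i
    gcongr
    have t1 : |L (zv p A i) * (∑ i, a i * a i)| ≤ K ^ 4 * (r * A.trace) := by
      rw [abs_mul, abs_of_nonneg n1]
      calc _ ≤ K ^ 3 * A.trace * (K * (r * 1)) := by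
            have := h.rho_le
            have q : K * r ^ 2 ≤ K * (r * 1) := by rw [sq]; gcongr
            have := h.Fd i
            gcongr
            linarith
        _ = _ := by ring
    have t2 : |2 * sigma2 A * a i| ≤ 2 * K ^ 4 * (r * A.trace) := by
      rw [abs_mul, abs_of_pos (by linarith [h.pw.s2])]
      have h1 := h.pw.one_le
      calc _ ≤ 2 * K * (K * r) := by
            have := h.pw.hi; have := h.ai_le i; gcongr
        _ = 2 * (K ^ 2 * r) * 1 := by ring
        _ ≤ 2 * (K ^ 2 * r) * (K * A.trace) := by gcongr
        _ = 2 * K ^ 3 * (r * A.trace) := by ring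
        _ ≤ _ := by
            have : K ^ 3 ≤ K ^ 4 := pow_le_pow_right₀ hK (by norm_num)
            gcongr
    have t3 : |2 * ∑ k, w k * A i k| ≤ 6 * K ^ 4 * (r * A.trace) := by
      rw [abs_mul, abs_of_pos (by norm_num : (0:ℝ) < 2)]
      have : |∑ k, w k * A i k| ≤ ∑ k : Fin 3, r * A.trace := by
        refine (Finset.abs_sum_le_sum_abs _ _).trans (Finset.sum_le_sum fun k _ => ?_)
        rw [abs_mul]
        have := h.wi_le k; have := h.pw.entry i k
        gcongr
      simp at this
      have q : 1 ≤ K ^ 4 := one_le_pow₀ hK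
      have q2 : 1 * (r * A.trace) ≤ K ^ 4 * (r * A.trace) := by gcongr
      linarith
    refine (abs_add_three _ _ _).trans ?_
    linarith
  refine (Finset.abs_sum_le_sum_abs _ _).trans ?_
  refine (Finset.sum_le_sum fun k _ => key k).trans ?_
  simp
  have q : K ^ 5 * r * A.trace ≤ K ^ 5 * r * (3 / 2 * K * WW A) := by
    have := h.pw.b_le; gcongr
  have : 0 ≤ K ^ 6 * r * WW A := by positivity
  nlinarith

/-- lower bound for `S : D²(Δu)` -/
lemma P1 (h : PD K p A L D T a w r) (db : Fin 3 → ℝ) (hdb : ∀ k, db k = ∑ i, T k i i) (sb : ℝ)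
    (hsb : sb = ∑ k, (D (zv p A k) (zv p A k)) + L (0, A.trace, WithLp.toLp 2 db)
      + ∑ k, (∑ i, ∑ j, T k i j ^ 2 - db k ^ 2)) :
    ∑ l, L (0, 0, EuclideanSpace.single l 1) * db l - 7 * K ^ 7 * A.trace ^ 2 ≤ sb := by
  have hK := h.pw.hK
  have hb := h.pw.h1
  have k1 : ∀ k, -(K ^ 5 * A.trace ^ 2) ≤ D (zv p A k) (zv p A k) := fun k => by
    have h1 := D.le_opNorm₂ (zv p A k) (zv p A k)
    have h2 := h.pw.norm_z k
    have h3 := h.hD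
    have : |D (zv p A k) (zv p A k)| ≤ K * (K ^ 2 * A.trace) * (K ^ 2 * A.trace) := by
      refine h1.trans ?_; gcongr
    have := (abs_le.1 this).1
    linarith
  have k2 : ∀ k, -(K ^ 7 * A.trace ^ 2) ≤ ∑ i, ∑ j, T k i j ^ 2 - db k ^ 2 := fun k => by
    have c1 := concav A (Matrix.of (T k)) h.pw.hA h.pw.s2 hb
    have et : (Matrix.of (T k)).trace = db k := by rw [hdb]; rfl
    rw [et] at c1
    simp only [Matrix.of_apply] at c1
    rw [h.hT] at c1
    have c2 : (L (zv p A k)) ^ 2 ≤ (K ^ 3 * A.trace) ^ 2 := by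
      rw [← sq_abs]; have := h.Fd k; gcongr
    by_contra hn
    push Not at hn
    set X := db k ^ 2 - ∑ i, ∑ j, T k i j ^ 2 with hX
    have hXp : K ^ 7 * A.trace ^ 2 < X := by linarith
    have hX0 : 0 < X := lt_trans (by positivity) hXp
    have c3 : 2 * (1 / K) * X ≤ 2 * sigma2 A * X := by have := h.pw.lo; gcongr
    have c4 : 2 * (1 / K) * (K ^ 7 * A.trace ^ 2) < 2 * (1 / K) * X := by
      have := h.pw.K0; gcongr
    have c5 : 2 * (1 / K) * (K ^ 7 * A.trace ^ 2) = 2 * (K ^ 3 * A.trace) ^ 2 := by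
      have := h.pw.K0; field_simp
    nlinarith [sq_nonneg (K ^ 3 * A.trace)]
  have k3 : L (0, A.trace, WithLp.toLp 2 db) =
      A.trace * L (0, 1, 0) + ∑ l, L (0, 0, EuclideanSpace.single l 1) * db l := by
    have : ((0, A.trace, WithLp.toLp 2 db) : E3 × ℝ × E3) =
        A.trace • (0, 1, 0) + ∑ l, db l • (0, 0, EuclideanSpace.single l 1) := by
      refine Prod.ext ?_ (Prod.ext ?_ ?_)
      · simp [Prod.fst_sum]
      · simp [Prod.fst_sum, Prod.snd_sum]
      · ext k; simp [Prod.snd_sum, Pi.single_apply]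
    rw [this]
    simp only [map_add, map_sum, map_smul, smul_eq_mul, mul_comm]
  have k4 : |L (0, 1, 0)| ≤ K := by
    refine (L.le_opNorm _).trans ?_
    have := h.hL
    simpa [Prod.norm_def] using this
  have k5 : -(K ^ 2 * A.trace ^ 2) ≤ A.trace * L (0, 1, 0) := by
    have h1 := (abs_le.1 k4).1
    have h2 := h.pw.one_le
    have h3 := mul_le_mul_of_nonneg_left h1 hb.le
    have h4 : A.trace * K * 1 ≤ A.trace * K * (K * A.trace) := by gcongr
    nlinarith
  rw [hsb, k3]
  have s1 := Finset.sum_le_sum fun k (_ : k ∈ Finset.univ) => k1 k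
  have s2 := Finset.sum_le_sum fun k (_ : k ∈ Finset.univ) => k2 k
  simp only [Finset.sum_const, Finset.card_univ, Fintype.card_fin, nsmul_eq_mul] at s1 s2
  push_cast at s1 s2
  -- crude comparison of powers
  have q5 : K ^ 5 ≤ K ^ 7 := pow_le_pow_right₀ hK (by norm_num)
  have q2 : K ^ 2 ≤ K ^ 7 := pow_le_pow_right₀ hK (by norm_num)
  have r5 : K ^ 5 * A.trace ^ 2 ≤ K ^ 7 * A.trace ^ 2 := by gcongr
  have r2 : K ^ 2 * A.trace ^ 2 ≤ K ^ 7 * A.trace ^ 2 := by gcongr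
  linarith
end PD

namespace Rad

def e (q : ℝ) : ℝ := q ^ (-(1 / 4) : ℝ)

lemma e_pos {q : ℝ} (hq : 0 < q) : 0 < e q := Real.rpow_pos_of_pos hq _

lemma e_four {q : ℝ} (hq : 0 < q) : e q ^ 4 * q = 1 := by
  unfold e
  rw [← Real.rpow_natCast, ← Real.rpow_mul hq.le]
  norm_num
  rw [Real.rpow_neg_one]; field_simp

lemma e_deriv {q : ℝ} (hq : 0 < q) : HasDerivAt e (-(e q ^ 5 / 4)) q := by
  have h := Real.hasDerivAt_rpow_const (x := q) (p := (-(1 / 4) : ℝ)) (Or.inl hq.ne')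
  have e5 : e q ^ 5 = q ^ (-(1 / 4) - 1 : ℝ) := by
    unfold e
    rw [← Real.rpow_natCast, ← Real.rpow_mul hq.le]
    norm_num
  rw [e5]
  exact HasDerivAt.congr_deriv (f := e) h (by ring)

lemma e_anti {q Q : ℝ} (hq : 0 < q) (h : q ≤ Q) : e Q ≤ e q :=
  Real.rpow_le_rpow_of_nonpos hq h (by norm_num)

def P (q : ℝ) : ℝ := e q ^ 2 + 2 * e q
def P1 (q : ℝ) : ℝ := -(e q ^ 6 / 2) - e q ^ 5 / 2
def P2 (q : ℝ) : ℝ := 3 / 4 * e q ^ 10 + 5 / 8 * e q ^ 9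

lemma P_deriv {q : ℝ} (hq : 0 < q) : HasDerivAt P (P1 q) q := by
  have h := e_deriv hq
  have := (h.fun_pow 2).add (h.const_mul 2)
  exact HasDerivAt.congr_deriv (f := P) this (by simp [P1]; ring)

lemma P1_deriv {q : ℝ} (hq : 0 < q) : HasDerivAt P1 (P2 q) q := by
  have h := e_deriv hq
  have := (((h.fun_pow 6).div_const 2).neg).sub ((h.fun_pow 5).div_const 2)
  exact HasDerivAt.congr_deriv (f := P1) this (by simp [P2]; ring)

lemma P2_cont : ContinuousOn P2 (Set.Ioi 0) := by
  have : ContinuousOn e (Set.Ioi 0) := fun q hq => (e_deriv hq).continuousAt.continuousWithinAt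
  unfold P2; fun_prop

lemma P2_anti {q Q : ℝ} (hq : 0 < q) (h : q ≤ Q) : P2 Q ≤ P2 q := by
  have h1 := e_anti hq h
  have h2 := e_pos (hq.trans_le h)
  unfold P2; gcongr

def H (Q q : ℝ) : ℝ := if q ≤ Q then P q - P Q - P1 Q * (q - Q) - P2 Q * (q - Q) ^ 2 / 2 else 0
def H1 (Q q : ℝ) : ℝ := if q ≤ Q then P1 q - P1 Q - P2 Q * (q - Q) else 0
def H2 (Q q : ℝ) : ℝ := max (P2 q - P2 Q) 0

lemma glue {g g' : ℝ → ℝ} {Q q : ℝ} (hg : HasDerivAt g (g' q) q) (h0 : g Q = 0) (h1 : g' Q = 0) :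
    HasDerivAt (fun x => if x ≤ Q then g x else 0) (if q ≤ Q then g' q else 0) q := by
  rcases lt_trichotomy q Q with h | h | h
  · rw [if_pos h.le]
    apply hg.congr_of_eventuallyEq
    filter_upwards [Iio_mem_nhds h] with x hx
    rw [if_pos (le_of_lt hx)]
  · subst h
    rw [if_pos le_rfl]
    have a : HasDerivWithinAt (fun x => if x ≤ q then g x else 0) (g' q) (Set.Iic q) q := by
      apply hg.hasDerivWithinAt.congr
      · intro x hx; rw [if_pos (Set.mem_Iic.1 hx)]
      · rw [if_pos le_rfl]
    have b : HasDerivWithinAt (fun x => if x ≤ q then g x else 0) (g' q) (Set.Ici q) q := by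
      rw [h1]
      apply (hasDerivWithinAt_const q (Set.Ici q) (0 : ℝ)).congr
      · intro x hx
        rcases eq_or_lt_of_le (Set.mem_Ici.1 hx) with h | h
        · subst h; simp [h0]
        · rw [if_neg (not_le.2 h)]
      · simp [h0]
    have := a.union b
    rw [Set.Iic_union_Ici] at this
    exact hasDerivWithinAt_univ.1 this
  · rw [if_neg (not_le.2 h)]
    apply (hasDerivAt_const q (0 : ℝ)).congr_of_eventuallyEq
    filter_upwards [Ioi_mem_nhds h] with x hx
    rw [if_neg (not_le.2 hx)]

lemma H_deriv {Q q : ℝ} (hq : 0 < q) : HasDerivAt (H Q) (H1 Q q) q := by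
  have h := P_deriv hq
  have hid : HasDerivAt (fun x : ℝ => x - Q) 1 q := (hasDerivAt_id q).sub_const Q
  have hg : HasDerivAt (fun q => P q - P Q - P1 Q * (q - Q) - P2 Q * (q - Q) ^ 2 / 2)
      (P1 q - P1 Q - P2 Q * (q - Q)) q := by
    have := ((h.sub_const (P Q)).sub (hid.const_mul (P1 Q))).sub
      (((hid.fun_pow 2).const_mul (P2 Q)).div_const 2)
    exact this.congr_deriv (by simp; ring)
  exact glue (g' := fun q => P1 q - P1 Q - P2 Q * (q - Q)) hg (by simp) (by simp)

lemma H1_deriv {Q q : ℝ} (hQ : 0 < Q) (hq : 0 < q) : HasDerivAt (H1 Q) (H2 Q q) q := by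
  have h := P1_deriv hq
  have hid : HasDerivAt (fun x : ℝ => x - Q) 1 q := (hasDerivAt_id q).sub_const Q
  have hg : HasDerivAt (fun q => P1 q - P1 Q - P2 Q * (q - Q)) (P2 q - P2 Q) q := by
    have := (h.sub_const (P1 Q)).sub (hid.const_mul (P2 Q))
    exact this.congr_deriv (by simp)
  have := glue (Q := Q) (g' := fun q => P2 q - P2 Q) hg (by simp) (by simp)
  refine HasDerivAt.congr_deriv (f := H1 Q) this ?_
  unfold H2
  split_ifs with hc
  · exact (max_eq_left (by linarith [P2_anti hq hc])).symm
  · push Not at hc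
    exact (max_eq_right (by linarith [P2_anti hQ hc.le])).symm

lemma H2_cont {Q : ℝ} : ContinuousOn (H2 Q) (Set.Ioi 0) := by
  have := P2_cont
  unfold H2; fun_prop

lemma contDiffAt_of {g g' : ℝ → ℝ} (h : ∀ q, 0 < q → HasDerivAt g (g' q) q)
    (hc : ContinuousOn g' (Set.Ioi 0)) {q : ℝ} (hq : 0 < q) : ContDiffAt ℝ 1 g q := by
  rw [contDiffAt_one_iff]
  refine ⟨fun x => ContinuousLinearMap.toSpanSingleton ℝ (g' x), Set.Ioi 0, Ioi_mem_nhds hq, ?_,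
    fun x hx => (h x hx).hasFDerivAt⟩
  exact (ContinuousLinearMap.toSpanSingletonCLE (𝕜 := ℝ) (E := ℝ)).continuous.comp_continuousOn hc

lemma H1_contDiff {Q q : ℝ} (hQ : 0 < Q) (hq : 0 < q) : ContDiffAt ℝ 1 (H1 Q) q :=
  contDiffAt_of (fun _ h => H1_deriv hQ h) H2_cont hq

lemma H_contDiff {Q q : ℝ} (hQ : 0 < Q) (hq : 0 < q) : ContDiffAt ℝ 1 (H Q) q :=
  contDiffAt_of (fun _ h => H_deriv h)
    (fun _ h => (H1_deriv hQ h).continuousAt.continuousWithinAt) hq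

lemma H2_nonneg (Q q : ℝ) : 0 ≤ H2 Q q := le_max_right _ _

lemma H1_nonpos {Q q : ℝ} (hQ : 0 < Q) (hq : 0 < q) : H1 Q q ≤ 0 := by
  by_cases hc : q ≤ Q
  · have hm : MonotoneOn (H1 Q) (Set.Ioi 0) := by
      apply monotoneOn_of_hasDerivWithinAt_nonneg (f' := H2 Q) (convex_Ioi 0)
      · exact fun x hx => (H1_deriv hQ hx).continuousAt.continuousWithinAt
      · intro x hx; rw [interior_Ioi] at hx; exact (H1_deriv hQ hx).hasDerivWithinAt
      · intro x _; exact H2_nonneg _ _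
    have := hm hq hQ hc
    simpa [H1] using this
  · simp [H1, hc]

lemma H_nonneg {Q q : ℝ} (hQ : 0 < Q) (hq : 0 < q) : 0 ≤ H Q q := by
  by_cases hc : q ≤ Q
  · have hm : AntitoneOn (H Q) (Set.Ioi 0) := by
      apply antitoneOn_of_hasDerivWithinAt_nonpos (f' := H1 Q) (convex_Ioi 0)
      · exact fun x hx => (H_deriv hx).continuousAt.continuousWithinAt
      · intro x hx; rw [interior_Ioi] at hx; exact (H_deriv hx).hasDerivWithinAt
      · intro x hx; rw [interior_Ioi] at hx; exact H1_nonpos hQ hx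
    have := hm hq hQ hc
    simpa [H] using this
  · simp [H, hc]

lemma H_zero {Q q : ℝ} (hQ : 0 < Q) (h : Q ≤ q) : H Q q = 0 ∧ H1 Q q = 0 ∧ H2 Q q = 0 := by
  refine ⟨?_, ?_, max_eq_right (by linarith [P2_anti hQ h])⟩
  · unfold H; split_ifs with hc
    · obtain rfl := le_antisymm hc h; simp
    · rfl
  · unfold H1; split_ifs with hc
    · obtain rfl := le_antisymm hc h; simp
    · rfl

set_option maxHeartbeats 2000000 in
/-- The radial inequality. -/
lemma main {C δ R r : ℝ} (hC : 1 ≤ C) (hδ : 0 < δ) (hδR : δ ≤ R) (hR : R ≤ 1 / (800 * C ^ 2))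
    (hr : 0 ≤ r) (hrR : r ≤ R) :
    (if r ≤ δ then 1 / (2 * δ ^ 3) else 0) - 18 / R ^ 3 ≤
      -(C * H (R ^ 2 + δ ^ 2) (r ^ 2 + δ ^ 2)) - H1 (R ^ 2 + δ ^ 2) (r ^ 2 + δ ^ 2) * (6 - C * r)
      - 4 * r ^ 2 * H2 (R ^ 2 + δ ^ 2) (r ^ 2 + δ ^ 2) * (1 + C * r) := by
  have hR0 : 0 < R := hδ.trans_le hδR
  set Q := R ^ 2 + δ ^ 2 with hQd
  set q := r ^ 2 + δ ^ 2 with hqd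
  have hq : 0 < q := by positivity
  have hQ : 0 < Q := by positivity
  have hqQ : q ≤ Q := by simp only [hqd, hQd]; gcongr
  have i0 := e_pos hq
  have I0 := e_pos hQ
  have i4 := e_four hq
  have I4 := e_four hQ
  have iI := e_anti hq hqQ
  set i := e q with hi
  set I := e Q with hI
  -- size of I
  have hIC : 20 * C ≤ I := by
    have h1 : Q ≤ 2 * (1 / (800 * C ^ 2)) ^ 2 := by
      have : R ^ 2 ≤ (1 / (800 * C ^ 2)) ^ 2 := by gcongr
      have : δ ^ 2 ≤ R ^ 2 := by gcongr
      simp only [hQd]; linarith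
    by_contra hn
    push Not at hn
    have h2 : I ^ 4 < (20 * C) ^ 4 := by gcongr
    have h3 : I ^ 4 * Q < (20 * C) ^ 4 * (2 * (1 / (800 * C ^ 2)) ^ 2) := by
      calc I ^ 4 * Q < (20 * C) ^ 4 * Q := by gcongr
        _ ≤ _ := by gcongr
    have h4 : (20 * C) ^ 4 * (2 * (1 / (800 * C ^ 2)) ^ 2) = 1 / 2 := by
      have : C ≠ 0 := by positivity
      field_simp; norm_num
    linarith
  have hI1 : 1 ≤ I := by linarith
  have hi1 : 1 ≤ i := by linarith
  have hri : r * i ^ 2 ≤ 1 := by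
    have : (r * i ^ 2) ^ 2 ≤ 1 ^ 2 := by
      have : r ^ 2 ≤ q := by simp only [hqd]; nlinarith
      calc (r * i ^ 2) ^ 2 = i ^ 4 * r ^ 2 := by ring
        _ ≤ i ^ 4 * q := by gcongr
        _ = 1 ^ 2 := by rw [i4]; norm_num
    exact le_of_sq_le_sq this (by norm_num)
  have hRI : I ^ 6 * R ^ 3 ≤ 1 := by
    have h1 : (I ^ 2 * R) ^ 2 ≤ 1 ^ 2 := by
      have : R ^ 2 ≤ Q := by simp only [hQd]; nlinarith
      calc (I ^ 2 * R) ^ 2 = I ^ 4 * R ^ 2 := by ring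
        _ ≤ I ^ 4 * Q := by gcongr
        _ = 1 ^ 2 := by rw [I4]; norm_num
    have h2 : I ^ 2 * R ≤ 1 := le_of_sq_le_sq h1 (by norm_num)
    calc I ^ 6 * R ^ 3 = (I ^ 2 * R) ^ 3 := by ring
      _ ≤ 1 := pow_le_one₀ (by positivity) h2
  -- H bound
  have b1 : H Q q ≤ 3 * i ^ 4 := by
    have hP2 : 0 ≤ P2 Q := by unfold P2; positivity
    have : H Q q ≤ P q := by
      simp only [H, if_pos hqQ]
      have : 0 ≤ P Q := by unfold P; positivity
      have : 0 ≤ P1 Q * (q - Q) := by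
        apply mul_nonneg_of_nonpos_of_nonpos
        · unfold P1; have : 0 ≤ e Q ^ 6 / 2 + e Q ^ 5 / 2 := by positivity
          linarith
        · linarith
      have : 0 ≤ P2 Q * (q - Q) ^ 2 / 2 := by positivity
      linarith
    refine this.trans ?_
    simp only [P, ← hi]
    have h2 : i ^ 2 ≤ i ^ 4 := pow_le_pow_right₀ hi1 (by norm_num)
    have h3 : i ^ 1 ≤ i ^ 4 := pow_le_pow_right₀ hi1 (by norm_num)
    linarith
  set E := (I ^ 6 / 2 + I ^ 5 / 2) + (3 / 4 * I ^ 10 + 5 / 8 * I ^ 9) * (Q - q) with hE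
  have b2 : H1 Q q = -(i ^ 6 / 2 + i ^ 5 / 2) + E := by
    simp only [H1, if_pos hqQ, P1, P2, ← hi, ← hI, hE]; ring
  have I56 : I ^ 5 ≤ I ^ 6 := pow_le_pow_right₀ hI1 (by norm_num)
  have E0 : 0 ≤ E := by have := sub_nonneg.2 hqQ; positivity
  have b3 : E ≤ 3 * I ^ 6 := by
    have h1 : (3 / 4 * I ^ 10 + 5 / 8 * I ^ 9) * (Q - q) ≤ (3 / 4 * I ^ 10 + 5 / 8 * I ^ 9) * Q := by
      gcongr; linarith
    have h2 : (3 / 4 * I ^ 10 + 5 / 8 * I ^ 9) * Q = (3 / 4 * I ^ 6 + 5 / 8 * I ^ 5) * (I ^ 4 * Q) := by ring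
    rw [I4] at h2
    have : 0 < I ^ 6 := by positivity
    linarith
  have b4 : H2 Q q ≤ 3 / 4 * i ^ 10 + 5 / 8 * i ^ 9 := by
    have : 0 ≤ P2 Q := by unfold P2; positivity
    apply max_le
    · simp only [P2, ← hi] at *; linarith
    · positivity
  have hH1 := H1_nonpos hQ hq
  have hH2 := H2_nonneg Q q
  have i56 : i ^ 5 ≤ i ^ 6 := pow_le_pow_right₀ hi1 (by norm_num)
  have i910 : i ^ 9 ≤ i ^ 10 := pow_le_pow_right₀ hi1 (by norm_num)
  -- individual terms
  have t1 : C * H Q q ≤ 3 * C * i ^ 4 := by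
    have := mul_le_mul_of_nonneg_left b1 (by positivity : 0 ≤ C); linarith
  have t2 : -H1 Q q * (C * r) ≤ C * i ^ 4 := by
    have : -H1 Q q ≤ i ^ 6 := by rw [b2]; linarith
    calc -H1 Q q * (C * r) ≤ i ^ 6 * (C * r) := by gcongr
      _ = C * i ^ 4 * (r * i ^ 2) := by ring
      _ ≤ C * i ^ 4 * 1 := by gcongr
      _ = _ := by ring
  have t3 : 4 * r ^ 2 * H2 Q q ≤ 3 * i ^ 6 + 5 / 2 * i ^ 5 - 3 * δ ^ 2 * i ^ 10 := by
    have h1 : 4 * r ^ 2 * H2 Q q ≤ 4 * r ^ 2 * (3 / 4 * i ^ 10 + 5 / 8 * i ^ 9) := by gcongr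
    have h2 : r ^ 2 = q - δ ^ 2 := by simp only [hqd]; ring
    have h3 : 4 * q * (3 / 4 * i ^ 10 + 5 / 8 * i ^ 9) = 4 * (3 / 4 * i ^ 6 + 5 / 8 * i ^ 5) * (i ^ 4 * q) := by ring
    rw [i4] at h3
    have h4 : 0 ≤ δ ^ 2 * i ^ 9 := by positivity
    rw [h2] at h1 ⊢
    linarith
  have t4 : 4 * r ^ 2 * H2 Q q * (C * r) ≤ 6 * C * i ^ 4 := by
    have : H2 Q q ≤ 3 / 2 * i ^ 10 := by
      have : 0 < i ^ 10 := by positivity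
      linarith
    calc 4 * r ^ 2 * H2 Q q * (C * r) ≤ 4 * r ^ 2 * (3 / 2 * i ^ 10) * (C * r) := by gcongr
      _ = 6 * C * i ^ 4 * (r * i ^ 2) ^ 3 := by ring
      _ ≤ 6 * C * i ^ 4 * 1 := by gcongr; exact pow_le_one₀ (by positivity) hri
      _ = _ := by ring
  have t5 : 10 * C * i ^ 4 ≤ i ^ 5 / 2 := by
    have : 20 * C ≤ i := hIC.trans iI
    have := mul_le_mul_of_nonneg_right this (by positivity : 0 ≤ i ^ 4)
    linarith [show i * i ^ 4 = i ^ 5 by ring]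
  have t6 : I ^ 6 ≤ 1 / R ^ 3 := by rw [le_div_iff₀ (by positivity)]; exact hRI
  have t7 : (if r ≤ δ then 1 / (2 * δ ^ 3) else 0) ≤ 3 * δ ^ 2 * i ^ 10 := by
    split_ifs with hc
    · have h1 : q ≤ 2 * δ ^ 2 := by
        have : r ^ 2 ≤ δ ^ 2 := by gcongr
        simp only [hqd]; linarith
      have h2 : 1 ≤ i ^ 4 * (2 * δ ^ 2) := by rw [← i4]; gcongr
      have h3 : 1 ≤ (i ^ 4 * (2 * δ ^ 2)) ^ 5 := one_le_pow₀ h2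
      have h4 : 1 ^ 2 ≤ (6 * (i ^ 10 * δ ^ 5)) ^ 2 := by
        have e1 : (i ^ 4 * (2 * δ ^ 2)) ^ 5 = 32 * (i ^ 10 * δ ^ 5) ^ 2 := by ring
        rw [e1] at h3
        nlinarith [sq_nonneg (i ^ 10 * δ ^ 5)]
      have h5 : 1 ≤ 6 * (i ^ 10 * δ ^ 5) := le_of_sq_le_sq h4 (by positivity)
      rw [div_le_iff₀ (by positivity)]
      linarith [show 3 * δ ^ 2 * i ^ 10 * (2 * δ ^ 3) = 6 * (i ^ 10 * δ ^ 5) by ring]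
    · positivity
  have e18 : 18 / R ^ 3 = 18 * (1 / R ^ 3) := by ring
  rw [e18]
  have g1 : -H1 Q q * 6 = 3 * i ^ 6 + 3 * i ^ 5 - 6 * E := by rw [b2]; ring
  linarith

end Rad


lemma pd_add (i : Fin 3) {g h : E3 → ℝ} {x : E3} (hg : DifferentiableAt ℝ g x)
    (hh : DifferentiableAt ℝ h x) : pd i (fun x => g x + h x) x = pd i g x + pd i h x := by
  simp [pd, fderiv_fun_add hg hh]

lemma pd_sub (i : Fin 3) {g h : E3 → ℝ} {x : E3} (hg : DifferentiableAt ℝ g x)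
    (hh : DifferentiableAt ℝ h x) : pd i (fun x => g x - h x) x = pd i g x - pd i h x := by
  simp [pd, fderiv_fun_sub hg hh]

lemma pd_mul (i : Fin 3) {g h : E3 → ℝ} {x : E3} (hg : DifferentiableAt ℝ g x)
    (hh : DifferentiableAt ℝ h x) :
    pd i (fun x => g x * h x) x = g x * pd i h x + pd i g x * h x := by
  simp [pd, fderiv_fun_mul hg hh]; ring

lemma pd_const (i : Fin 3) (c : ℝ) (x : E3) : pd i (fun _ => c) x = 0 := by
  simp [pd]

lemma pd_sum (i : Fin 3) {ι : Type*} [Fintype ι] {g : ι → E3 → ℝ} {x : E3}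
    (hg : ∀ k, DifferentiableAt ℝ (g k) x) :
    pd i (fun x => ∑ k, g k x) x = ∑ k, pd i (g k) x := by
  simp [pd, fderiv_fun_sum (fun k _ => hg k)]

lemma pd_comp (i : Fin 3) {g : E3 → ℝ} {φ : ℝ → ℝ} {c : ℝ} {x : E3} (hg : DifferentiableAt ℝ g x)
    (hφ : HasDerivAt φ c (g x)) : pd i (fun x => φ (g x)) x = c * pd i g x := by
  have := (hφ.comp_hasFDerivAt x hg.hasFDerivAt).fderiv
  have e : fderiv ℝ (fun x => φ (g x)) x = c • fderiv ℝ g x := this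
  simp [pd, e]

lemma pd_congr (i : Fin 3) {g h : E3 → ℝ} {U : Set E3} (hU : IsOpen U) (hgh : ∀ x ∈ U, g x = h x)
    {x : E3} (hx : x ∈ U) : pd i g x = pd i h x := by
  have : g =ᶠ[nhds x] h := by
    filter_upwards [hU.mem_nhds hx] with y hy using hgh y hy
  simp [pd, this.fderiv_eq]

lemma pd_contDiff {g : E3 → ℝ} {n m : WithTop ℕ∞} (hg : ContDiff ℝ n g) (h : m + 1 ≤ n)
    (i : Fin 3) : ContDiff ℝ m (pd i g) := by
  have : ContDiff ℝ m (fderiv ℝ g) := hg.fderiv_right h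
  unfold pd
  exact this.clm_apply contDiff_const

lemma pd_smooth {g : E3 → ℝ} (hg : ContDiff ℝ (⊤ : ℕ∞) g) (i : Fin 3) :
    ContDiff ℝ (⊤ : ℕ∞) (pd i g) := pd_contDiff hg (by simp) i

lemma pd_diff {g : E3 → ℝ} (hg : ContDiff ℝ (⊤ : ℕ∞) g) : Differentiable ℝ g :=
  hg.differentiable (by simp)

lemma two_le_top : (2 : WithTop ℕ∞) ≤ ((⊤ : ℕ∞) : WithTop ℕ∞) := by
  change ((2 : ℕ∞) : WithTop ℕ∞) ≤ _
  exact WithTop.coe_le_coe.2 le_top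

lemma one_le_top' : (1 : WithTop ℕ∞) ≤ ((⊤ : ℕ∞) : WithTop ℕ∞) := by
  exact_mod_cast (le_top : (1 : ℕ∞) ≤ ⊤)

lemma pd_comm {g : E3 → ℝ} (hg : ContDiff ℝ 2 g) (i j : Fin 3) (x : E3) :
    pd i (pd j g) x = pd j (pd i g) x := by
  have hd : DifferentiableAt ℝ (fderiv ℝ g) x :=
    ((hg.fderiv_right (m := 1) (by norm_num)).differentiable (by norm_num)) x
  have key : ∀ i j, pd i (pd j g) x
      = fderiv ℝ (fderiv ℝ g) x (EuclideanSpace.single i 1) (EuclideanSpace.single j 1) := by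
    intro i j
    unfold pd
    rw [fderiv_clm_apply hd (by fun_prop)]
    simp
  rw [key, key]
  have : IsSymmSndFDerivAt ℝ g x := hg.contDiffAt.isSymmSndFDerivAt (by simp)
  exact this _ _

/-- the jet map -/
def zz (u : E3 → ℝ) (x : E3) : E3 × ℝ × E3 := (x, u x, grad u x)

section
variable {u : E3 → ℝ} {f : E3 × ℝ × E3 → ℝ}

lemma grad_contDiff (hu : ContDiff ℝ (⊤ : ℕ∞) u) : ContDiff ℝ (⊤ : ℕ∞) (grad u) := by
  rw [contDiff_euclidean]
  intro i
  exact pd_smooth hu i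

lemma zz_contDiff (hu : ContDiff ℝ (⊤ : ℕ∞) u) : ContDiff ℝ (⊤ : ℕ∞) (zz u) :=
  contDiff_id.prodMk (hu.prodMk (grad_contDiff hu))

lemma fderiv_toLp {g : Fin 3 → E3 → ℝ} {x : E3} (hg : ∀ k, DifferentiableAt ℝ (g k) x) (i : Fin 3) :
    HasFDerivAt (fun x => (WithLp.toLp 2 (fun k => g k x) : E3))
      (fderiv ℝ (fun x => (WithLp.toLp 2 (fun k => g k x) : E3)) x) x ∧
    fderiv ℝ (fun x => (WithLp.toLp 2 (fun k => g k x) : E3)) x (EuclideanSpace.single i 1)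
      = WithLp.toLp 2 (fun k => pd i (g k) x) := by
  have hd : DifferentiableAt ℝ (fun x => (WithLp.toLp 2 (fun k => g k x) : E3)) x := by
    rw [differentiableAt_euclidean]; exact hg
  refine ⟨hd.hasFDerivAt, ?_⟩
  ext k
  have h1 := (hasFDerivWithinAt_euclidean.1 (hd.hasFDerivAt.hasFDerivWithinAt (s := Set.univ))) k
  rw [hasFDerivWithinAt_univ] at h1
  have h2 : fderiv ℝ (g k) x = _ := h1.fderiv
  simp [pd, h2]

lemma zz_fderiv (hu : ContDiff ℝ (⊤ : ℕ∞) u) (x : E3) (i : Fin 3) :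
    fderiv ℝ (zz u) x (EuclideanSpace.single i 1) = zv (fun k => pd k u x) (hess u x) i := by
  obtain ⟨h1, h2⟩ := fderiv_toLp (g := fun k => pd k u) (x := x)
    (fun k => pd_diff (pd_smooth hu k) x) i
  have h3 : HasFDerivAt (zz u) _ x := (hasFDerivAt_id x).prodMk ((pd_diff hu x).hasFDerivAt.prodMk h1)
  rw [h3.fderiv]
  simp only [ContinuousLinearMap.prod_apply, h2]
  rfl

lemma zv_fderiv (hu : ContDiff ℝ (⊤ : ℕ∞) u) (x : E3) (i j : Fin 3) :
    HasFDerivAt (fun x => zv (fun k => pd k u x) (hess u x) j)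
      (fderiv ℝ (fun x => zv (fun k => pd k u x) (hess u x) j) x) x ∧
    fderiv ℝ (fun x => zv (fun k => pd k u x) (hess u x) j) x (EuclideanSpace.single i 1) =
      (0, hess u x i j, WithLp.toLp 2 (fun k => pd k (pd i (pd j u)) x)) := by
  obtain ⟨h1, h2⟩ := fderiv_toLp (g := fun k => pd j (pd k u)) (x := x)
    (fun k => pd_diff (pd_smooth (pd_smooth hu k) j) x) i
  have h3 : HasFDerivAt (fun x => zv (fun k => pd k u x) (hess u x) j) _ x :=
    (hasFDerivAt_const (EuclideanSpace.single j 1) x).prodMk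
      ((pd_diff (pd_smooth hu j) x).hasFDerivAt.prodMk h1)
  refine ⟨h3.differentiableAt.hasFDerivAt, ?_⟩
  rw [h3.fderiv]
  simp only [ContinuousLinearMap.prod_apply, h2]
  have e : ∀ k, pd i (pd j (pd k u)) x = pd k (pd i (pd j u)) x := by
    intro k
    have e1 : pd j (pd k u) = pd k (pd j u) := by
      ext y; exact pd_comm (hu.of_le two_le_top) _ _ _
    rw [e1]
    exact pd_comm ((pd_smooth hu j).of_le two_le_top) _ _ _
  simp only [e]
  rfl

lemma pd_F (hf : ContDiff ℝ 2 f) (hu : ContDiff ℝ (⊤ : ℕ∞) u) (x : E3) (i : Fin 3) :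
    pd i (fun x => f (zz u x)) x = fderiv ℝ f (zz u x) (zv (fun k => pd k u x) (hess u x) i) := by
  have h1 : HasFDerivAt (fun x => f (zz u x)) _ x := ((hf.differentiable (by norm_num)) (zz u x)).hasFDerivAt.comp x
    (((zz_contDiff hu).differentiable (by simp)) x).hasFDerivAt
  change fderiv ℝ (fun x => f (zz u x)) x _ = _
  rw [h1.fderiv]
  simp [zz_fderiv hu]

lemma pd_L (hf : ContDiff ℝ 2 f) (hu : ContDiff ℝ (⊤ : ℕ∞) u) (x : E3) (i : Fin 3)
    {ζ : E3 → E3 × ℝ × E3} (hζ : DifferentiableAt ℝ ζ x) :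
    pd i (fun x => fderiv ℝ f (zz u x) (ζ x)) x =
      fderiv ℝ (fderiv ℝ f) (zz u x) (zv (fun k => pd k u x) (hess u x) i) (ζ x)
      + fderiv ℝ f (zz u x) (fderiv ℝ ζ x (EuclideanSpace.single i 1)) := by
  have hd : DifferentiableAt ℝ (fderiv ℝ f) (zz u x) :=
    ((hf.fderiv_right (m := 1) (by norm_num)).differentiable (by norm_num)) _
  have h1 : HasFDerivAt (fun x => fderiv ℝ f (zz u x)) _ x := hd.hasFDerivAt.comp x
    (((zz_contDiff hu).differentiable (by simp)) x).hasFDerivAt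
  have h2 := h1.clm_apply hζ.hasFDerivAt
  change fderiv ℝ (fun y => (fderiv ℝ f (zz u y)) (ζ y)) x _ = _
  rw [h2.fderiv]
  simp [zz_fderiv hu, add_comm]

lemma pd_pd_F (hf : ContDiff ℝ 2 f) (hu : ContDiff ℝ (⊤ : ℕ∞) u) (x : E3) (i j : Fin 3) :
    pd i (pd j (fun x => f (zz u x))) x =
      fderiv ℝ (fderiv ℝ f) (zz u x) (zv (fun k => pd k u x) (hess u x) i)
        (zv (fun k => pd k u x) (hess u x) j)
      + fderiv ℝ f (zz u x) (0, hess u x i j, WithLp.toLp 2 (fun k => pd k (pd i (pd j u)) x)) := by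
  have e : pd j (fun x => f (zz u x)) = fun x => fderiv ℝ f (zz u x) (zv (fun k => pd k u x) (hess u x) j) := by
    ext y; exact pd_F hf hu y j
  obtain ⟨h1, h2⟩ := zv_fderiv hu x i j
  rw [e, pd_L hf hu x i h1.differentiableAt, h2]

lemma pd_fp (hf : ContDiff ℝ 2 f) (hu : ContDiff ℝ (⊤ : ℕ∞) u) (x : E3) (i j : Fin 3) :
    pd i (fp f u j) x = fderiv ℝ (fderiv ℝ f) (zz u x) (zv (fun k => pd k u x) (hess u x) i)
      (0, 0, EuclideanSpace.single j 1) := by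
  have := pd_L hf hu x i (ζ := fun _ => (0, 0, EuclideanSpace.single j 1)) (by fun_prop)
  simp only [fderiv_fun_const, Pi.zero_apply, zero_apply, map_zero, add_zero] at this
  exact this

lemma F_contDiff (hf : ContDiff ℝ 2 f) (hu : ContDiff ℝ (⊤ : ℕ∞) u) :
    ContDiff ℝ 2 (fun x => f (zz u x)) :=
  hf.comp ((zz_contDiff hu).of_le two_le_top)

lemma fp_contDiff (hf : ContDiff ℝ 2 f) (hu : ContDiff ℝ (⊤ : ℕ∞) u) (j : Fin 3) :
    ContDiff ℝ 1 (fp f u j) := by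
  have : ContDiff ℝ 1 (fun x => fderiv ℝ f (zz u x)) :=
    (hf.fderiv_right (m := 1) (by norm_num)).comp ((zz_contDiff hu).of_le (by exact_mod_cast le_top))
  exact this.clm_apply contDiff_const

end


/-- third derivatives -/
def TT (u : E3 → ℝ) (x : E3) (k i j : Fin 3) : ℝ := pd k (pd i (pd j u)) x

section
variable {u : E3 → ℝ} {f : E3 × ℝ × E3 → ℝ}

lemma d1 (hu : ContDiff ℝ (⊤ : ℕ∞) u) (i : Fin 3) (x : E3) : DifferentiableAt ℝ (pd i u) x :=
  pd_diff (pd_smooth hu i) x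
lemma d2 (hu : ContDiff ℝ (⊤ : ℕ∞) u) (i j : Fin 3) (x : E3) :
    DifferentiableAt ℝ (pd i (pd j u)) x := d1 (pd_smooth hu j) i x
lemma d3 (hu : ContDiff ℝ (⊤ : ℕ∞) u) (i j k : Fin 3) (x : E3) :
    DifferentiableAt ℝ (pd i (pd j (pd k u))) x := d2 (pd_smooth hu k) i j x

lemma pd_comm' (hu : ContDiff ℝ (⊤ : ℕ∞) u) (i j : Fin 3) : pd i (pd j u) = pd j (pd i u) := by
  ext x; exact pd_comm (hu.of_le two_le_top) i j x

lemma TT_swap (hu : ContDiff ℝ (⊤ : ℕ∞) u) (x : E3) (k i j : Fin 3) : TT u x k i j = TT u x k j i := by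
  unfold TT; rw [pd_comm' hu i j]

lemma TT_swap' (hu : ContDiff ℝ (⊤ : ℕ∞) u) (x : E3) (k i j : Fin 3) : TT u x k i j = TT u x i k j := by
  unfold TT; rw [pd_comm' (pd_smooth hu j)]

lemma hess_symm (hu : ContDiff ℝ (⊤ : ℕ∞) u) (x : E3) (i j : Fin 3) : hess u x i j = hess u x j i := by
  simp only [hess, Matrix.of_apply]; rw [pd_comm' hu i j]

lemma hess_trace (u : E3 → ℝ) (x : E3) : (hess u x).trace = lap u x := rfl

lemma lap_eq (u : E3 → ℝ) : lap u = fun x => ∑ i, pd i (pd i u) x := rfl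

lemma lap_smooth (hu : ContDiff ℝ (⊤ : ℕ∞) u) : ContDiff ℝ (⊤ : ℕ∞) (lap u) := by
  rw [lap_eq]
  exact ContDiff.sum fun i _ => pd_smooth (pd_smooth hu i) i

lemma pd_lap (hu : ContDiff ℝ (⊤ : ℕ∞) u) (x : E3) (k : Fin 3) : pd k (lap u) x = ∑ i, TT u x k i i := by
  rw [lap_eq, pd_sum k (fun i => d2 hu i i x)]; rfl

lemma pd_lap' (hu : ContDiff ℝ (⊤ : ℕ∞) u) (k : Fin 3) : pd k (lap u) = lap (pd k u) := by
  ext x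
  rw [pd_lap hu]
  simp only [lap, hess, Matrix.of_apply]
  apply Finset.sum_congr rfl
  intro i _
  rw [TT_swap' hu, TT_swap hu]; rfl

lemma pd_pd_lap (hu : ContDiff ℝ (⊤ : ℕ∞) u) (x : E3) (i j : Fin 3) :
    pd i (pd j (lap u)) x = ∑ k, pd k (pd k (pd i (pd j u))) x := by
  rw [pd_lap' hu, pd_lap' (pd_smooth hu j)]; rfl

/-- coefficient functions -/
def Sf (u : E3 → ℝ) (i j : Fin 3) (x : E3) : ℝ := SS (hess u x) i j

lemma Sf_eq (u : E3 → ℝ) (i j : Fin 3) :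
    Sf u i j = fun x => lap u x * (if i = j then 1 else 0) - pd i (pd j u) x := rfl

lemma Sf_symm (hu : ContDiff ℝ (⊤ : ℕ∞) u) (i j : Fin 3) (x : E3) : Sf u i j x = Sf u j i x := by
  simp only [Sf_eq, pd_comm' hu i j, eq_comm]

lemma Sf_smooth (hu : ContDiff ℝ (⊤ : ℕ∞) u) (i j : Fin 3) : ContDiff ℝ (⊤ : ℕ∞) (Sf u i j) := by
  rw [Sf_eq]
  exact ((lap_smooth hu).mul contDiff_const).sub (pd_smooth (pd_smooth hu j) i)

lemma pd_Sf (hu : ContDiff ℝ (⊤ : ℕ∞) u) (i j k : Fin 3) (x : E3) :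
    pd k (Sf u i j) x = pd k (lap u) x * (if i = j then 1 else 0) - TT u x k i j := by
  have h := pd_diff (lap_smooth hu)
  rw [Sf_eq, pd_sub k ((h x).fun_mul (by fun_prop)) (d2 hu i j x), pd_mul k (h x) (by fun_prop), pd_const]
  simp [TT]

lemma div_Sf (hu : ContDiff ℝ (⊤ : ℕ∞) u) (i : Fin 3) (x : E3) : ∑ j, pd j (Sf u i j) x = 0 := by
  simp only [pd_Sf hu, Finset.sum_sub_distrib, mul_ite, mul_one, mul_zero, Finset.sum_ite_eq,
    Finset.mem_univ, if_true, pd_lap hu]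
  rw [sub_eq_zero]
  apply Finset.sum_congr rfl
  intro j _
  exact TT_swap' hu x i j j

lemma pde1 (hu : ContDiff ℝ (⊤ : ℕ∞) u) {U : Set E3} (hU : IsOpen U)
    (hP : ∀ x ∈ U, sigma2 (hess u x) = f (zz u x)) {x : E3} (hx : x ∈ U) (k : Fin 3) :
    ∑ i, ∑ j, Sf u i j x * TT u x k i j = pd k (fun x => f (zz u x)) x := by
  rw [← pd_congr k hU hP hx]
  have e : (fun x => sigma2 (hess u x)) = fun x => (1 / 2) * (lap u x * lap u x -
      ∑ i, ∑ j, pd i (pd j u) x * pd i (pd j u) x) := by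
    ext y
    have := sigma2_frob (hess u y) (hess_symm hu y)
    rw [hess_trace] at this
    have e2 : ∑ i, ∑ j, hess u y i j ^ 2 = ∑ i, ∑ j, pd i (pd j u) y * pd i (pd j u) y := by
      simp only [pow_two]; rfl
    rw [e2] at this
    linarith
  have hl := pd_diff (lap_smooth hu)
  have h2 := d2 hu
  have dS : ∀ i, DifferentiableAt ℝ (fun x => ∑ j, pd i (pd j u) x * pd i (pd j u) x) x :=
    fun i => by fun_prop
  rw [e, pd_mul k (by fun_prop) (by fun_prop), pd_const, pd_sub k (by fun_prop) (by fun_prop),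
    pd_mul k (hl x) (hl x), pd_sum k dS]
  have e3 : ∀ i, pd k (fun x => ∑ j, pd i (pd j u) x * pd i (pd j u) x) x
      = ∑ j, 2 * (pd i (pd j u) x * TT u x k i j) := fun i => by
    rw [pd_sum k (fun j => (h2 i j x).fun_mul (h2 i j x))]
    apply Finset.sum_congr rfl
    intro j _
    rw [pd_mul k (h2 i j x) (h2 i j x)]; unfold TT; ring
  simp only [e3]
  simp only [Sf_eq, pd_lap hu, Fin.sum_univ_three]
  simp
  ring

lemma pde2 (hf : ContDiff ℝ 2 f) (hu : ContDiff ℝ (⊤ : ℕ∞) u) {U : Set E3} (hU : IsOpen U)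
    (hP : ∀ x ∈ U, sigma2 (hess u x) = f (zz u x)) {x : E3} (hx : x ∈ U) :
    ∑ i, ∑ j, Sf u i j x * pd i (pd j (lap u)) x =
      ∑ k, pd k (pd k (fun x => f (zz u x))) x
      + ∑ k, (∑ i, ∑ j, TT u x k i j ^ 2 - pd k (lap u) x ^ 2) := by
  have hS : ∀ i j, DifferentiableAt ℝ (Sf u i j) x := fun i j => pd_diff (Sf_smooth hu i j) x
  have h3 : ∀ k i j, DifferentiableAt ℝ (pd k (pd i (pd j u))) x := fun k i j => d3 hu k i j x
  have key : ∀ k, pd k (pd k (fun x => f (zz u x))) x =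
      ∑ i, ∑ j, (Sf u i j x * pd k (pd k (pd i (pd j u))) x + pd k (Sf u i j) x * TT u x k i j) := by
    intro k
    rw [← pd_congr k hU (fun y hy => pde1 hu hU hP hy k) hx]
    change pd k (fun x => ∑ i, ∑ j, Sf u i j x * pd k (pd i (pd j u)) x) x = _
    rw [pd_sum k (fun i => by fun_prop)]
    apply Finset.sum_congr rfl
    intro i _
    rw [pd_sum k (fun j => (hS i j).fun_mul (h3 k i j))]
    apply Finset.sum_congr rfl
    intro j _
    rw [pd_mul k (hS i j) (h3 k i j)]; rfl
  simp only [key, pd_Sf hu, pd_pd_lap hu]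
  have e : ∀ k, pd k (lap u) x = TT u x k 0 0 + TT u x k 1 1 + TT u x k 2 2 := fun k => by
    rw [pd_lap hu, Fin.sum_univ_three]
  simp only [e, Fin.sum_univ_three]
  simp
  ring

/-- the squared pseudo-distance plus `δ²` -/
def qq (f : E3 × ℝ × E3 → ℝ) (u : E3 → ℝ) (y : E3) (d : ℝ) (x : E3) : ℝ :=
  f (zz u x) * ∑ i, (x i - y i) * (x i - y i) +
    ∑ k, (pd k u x - pd k u y) * (pd k u x - pd k u y) + d ^ 2

lemma diff_coord (y : E3) (i : Fin 3) (x : E3) : DifferentiableAt ℝ (fun x : E3 => x i - y i) x := by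
  fun_prop

lemma pd_coord (y : E3) (i k : Fin 3) (x : E3) :
    pd k (fun x : E3 => x i - y i) x = if k = i then 1 else 0 := by
  have h : HasFDerivAt (fun x : E3 => x i - y i) (EuclideanSpace.proj i : E3 →L[ℝ] ℝ) x :=
    (EuclideanSpace.proj i : E3 →L[ℝ] ℝ).hasFDerivAt.sub_const _
  simp only [pd]
  rw [h.fderiv]
  simp [eq_comm]

lemma pd_q (hf : ContDiff ℝ 2 f) (hu : ContDiff ℝ (⊤ : ℕ∞) u) (y : E3) (d : ℝ) (x : E3) (j : Fin 3) :
    pd j (qq f u y d) x = pd j (fun x => f (zz u x)) x * (∑ i, (x i - y i) * (x i - y i))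
      + 2 * f (zz u x) * (x j - y j) + 2 * ∑ k, (pd k u x - pd k u y) * hess u x j k := by
  have hF : DifferentiableAt ℝ (fun x => f (zz u x)) x := (F_contDiff hf hu).differentiable (by norm_num) x
  have hw : ∀ k, DifferentiableAt ℝ (fun x => pd k u x - pd k u y) x := fun k => (d1 hu k x).sub_const _
  have hc := fun i => diff_coord y i x
  have pw : ∀ k, pd j (fun x => pd k u x - pd k u y) x = hess u x j k := fun k => by
    rw [pd_sub j (d1 hu k x) (by fun_prop), pd_const]; simp [hess]
  have hs1 : DifferentiableAt ℝ (fun x : E3 => ∑ i, (x i - y i) * (x i - y i)) x := by fun_prop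
  have hs2 : DifferentiableAt ℝ (fun x : E3 => ∑ k, (pd k u x - pd k u y) * (pd k u x - pd k u y)) x :=
    DifferentiableAt.fun_sum fun k _ => (hw k).fun_mul (hw k)
  unfold qq
  rw [pd_add j ((hF.fun_mul hs1).fun_add hs2) (by fun_prop), pd_const, pd_add j (hF.fun_mul hs1) hs2, pd_mul j hF hs1,
    pd_sum j (fun i => (hc i).fun_mul (hc i)), pd_sum j (fun k => (hw k).fun_mul (hw k))]
  have e1 : ∀ i, pd j (fun x : E3 => (x i - y i) * (x i - y i)) x
      = 2 * ((x i - y i) * (if j = i then 1 else 0)) := fun i => by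
    rw [pd_mul j (hc i) (hc i), pd_coord]; ring
  have e2 : ∀ k, pd j (fun x => (pd k u x - pd k u y) * (pd k u x - pd k u y)) x
      = 2 * ((pd k u x - pd k u y) * hess u x j k) := fun k => by
    rw [pd_mul j (hw k) (hw k), pw]; ring
  simp only [e1, e2, ← Finset.mul_sum, mul_ite, mul_one, mul_zero, Finset.sum_ite_eq,
    Finset.mem_univ, if_true]
  ring

lemma pd_pd_q (hf : ContDiff ℝ 2 f) (hu : ContDiff ℝ (⊤ : ℕ∞) u) (y : E3) (d : ℝ) (x : E3)
    (i j : Fin 3) :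
    pd i (pd j (qq f u y d)) x =
      pd i (pd j (fun x => f (zz u x))) x * (∑ i, (x i - y i) * (x i - y i))
      + 2 * pd i (fun x => f (zz u x)) x * (x j - y j) + 2 * pd j (fun x => f (zz u x)) x * (x i - y i)
      + 2 * f (zz u x) * (if i = j then 1 else 0) + 2 * ∑ k, hess u x i k * hess u x j k
      + 2 * ∑ k, (pd k u x - pd k u y) * TT u x k i j := by
  have hF : DifferentiableAt ℝ (fun x => f (zz u x)) x := (F_contDiff hf hu).differentiable (by norm_num) x
  have hF1 : DifferentiableAt ℝ (pd j (fun x => f (zz u x))) x :=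
    (pd_contDiff (m := 1) (F_contDiff hf hu) (by norm_num) j).differentiable (by norm_num) x
  have hw : ∀ k, DifferentiableAt ℝ (fun x => pd k u x - pd k u y) x := fun k => (d1 hu k x).sub_const _
  have hh : ∀ k, DifferentiableAt ℝ (fun x => hess u x j k) x := fun k => d2 hu j k x
  have hc := fun i => diff_coord y i x
  have pw : ∀ k, pd i (fun x => pd k u x - pd k u y) x = hess u x i k := fun k => by
    rw [pd_sub i (d1 hu k x) (by fun_prop), pd_const]; simp [hess]
  have ph : ∀ k, pd i (fun x => hess u x j k) x = TT u x k i j := fun k => by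
    have : pd i (fun x => hess u x j k) x = TT u x i j k := rfl
    rw [this, TT_swap hu, TT_swap' hu]
  have hs1 : DifferentiableAt ℝ (fun x : E3 => ∑ i, (x i - y i) * (x i - y i)) x := by fun_prop
  have hs2 : DifferentiableAt ℝ (fun x : E3 => ∑ k, (pd k u x - pd k u y) * hess u x j k) x :=
    DifferentiableAt.fun_sum fun k _ => (hw k).fun_mul (hh k)
  have hF2 : DifferentiableAt ℝ (fun x => 2 * f (zz u x)) x := hF.const_mul (2 : ℝ)
  have e : pd j (qq f u y d) = fun x => pd j (fun x => f (zz u x)) x * (∑ i, (x i - y i) * (x i - y i))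
      + 2 * f (zz u x) * (x j - y j) + 2 * ∑ k, (pd k u x - pd k u y) * hess u x j k := by
    ext x; exact pd_q hf hu y d x j
  rw [e, pd_add i ((hF1.fun_mul hs1).fun_add (hF2.fun_mul (hc j))) (hs2.const_mul 2),
    pd_add i (hF1.fun_mul hs1) (hF2.fun_mul (hc j)), pd_mul i hF1 hs1, pd_mul i hF2 (hc j),
    pd_mul i (by fun_prop) hF, pd_mul i (by fun_prop) hs2, pd_const,
    pd_sum i (fun i => (hc i).fun_mul (hc i)), pd_sum i (fun k => (hw k).fun_mul (hh k)), pd_coord]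
  have e1 : ∀ k, pd i (fun x : E3 => (x k - y k) * (x k - y k)) x
      = 2 * ((x k - y k) * (if i = k then 1 else 0)) := fun k => by
    rw [pd_mul i (hc k) (hc k), pd_coord]; ring
  have e2 : ∀ k, pd i (fun x => (pd k u x - pd k u y) * hess u x j k) x
      = (pd k u x - pd k u y) * TT u x k i j + hess u x i k * hess u x j k := fun k => by
    rw [pd_mul i (hw k) (hh k), pw, ph]
  simp only [e1, e2, ← Finset.mul_sum, Finset.sum_add_distrib, mul_ite, mul_one, mul_zero, Finset.sum_ite_eq,
    Finset.mem_univ, if_true]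
  split_ifs <;> ring

end


/-- The vector field. -/
def Vf (f : E3 × ℝ × E3 → ℝ) (u : E3 → ℝ) (y : E3) (d Q : ℝ) (j : Fin 3) (x : E3) : ℝ :=
  ∑ i, Sf u i j x * (Rad.H Q (qq f u y d x) * pd i (lap u) x
      - lap u x * (Rad.H1 Q (qq f u y d x) * pd i (qq f u y d) x))
    - Rad.H Q (qq f u y d x) * (lap u x * fp f u j x)

section
variable {u : E3 → ℝ} {f : E3 × ℝ × E3 → ℝ}

lemma qq_contDiff (hf : ContDiff ℝ 2 f) (hu : ContDiff ℝ (⊤ : ℕ∞) u) (y : E3) (d : ℝ) :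
    ContDiff ℝ 2 (qq f u y d) := by
  have hF := F_contDiff hf hu
  have h1 : ∀ k, ContDiff ℝ 2 (pd k u) := fun k => (pd_smooth hu k).of_le two_le_top
  have h2 : ContDiff ℝ 2 (fun x : E3 => ∑ i, (x i - y i) * (x i - y i)) := by fun_prop
  have h3 : ContDiff ℝ 2 (fun x : E3 => ∑ k, (pd k u x - pd k u y) * (pd k u x - pd k u y)) :=
    ContDiff.sum fun k _ => ((h1 k).sub contDiff_const).mul ((h1 k).sub contDiff_const)
  unfold qq
  exact ((hF.mul h2).add h3).add contDiff_const

lemma qq_ge (hf0 : ∀ z, 0 ≤ f z) (y : E3) (d : ℝ) (x : E3) : d ^ 2 ≤ qq f u y d x := by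
  unfold qq
  have h1 : 0 ≤ f (zz u x) * ∑ i, (x i - y i) * (x i - y i) :=
    mul_nonneg (hf0 _) (Finset.sum_nonneg fun i _ => mul_self_nonneg _)
  have h2 : 0 ≤ ∑ k, (pd k u x - pd k u y) * (pd k u x - pd k u y) :=
    Finset.sum_nonneg fun i _ => mul_self_nonneg _
  linarith

lemma qq_pos (hf0 : ∀ z, 0 ≤ f z) (y : E3) {d : ℝ} (hd : 0 < d) (x : E3) : 0 < qq f u y d x :=
  lt_of_lt_of_le (by positivity) (qq_ge hf0 y d x)

lemma Vf_contDiff (hf : ContDiff ℝ 2 f) (hu : ContDiff ℝ (⊤ : ℕ∞) u) (hf0 : ∀ z, 0 ≤ f z) (y : E3)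
    {d Q : ℝ} (hd : 0 < d) (hQ : 0 < Q) (j : Fin 3) : ContDiff ℝ 1 (Vf f u y d Q j) := by
  have hq := qq_contDiff hf hu y d
  have hq1 : ContDiff ℝ 1 (qq f u y d) := hq.of_le (by norm_num)
  have hH : ContDiff ℝ 1 (fun x => Rad.H Q (qq f u y d x)) := by
    rw [contDiff_iff_contDiffAt]; intro x
    exact (Rad.H_contDiff hQ (qq_pos hf0 y hd x)).comp x hq1.contDiffAt
  have hH1 : ContDiff ℝ 1 (fun x => Rad.H1 Q (qq f u y d x)) := by
    rw [contDiff_iff_contDiffAt]; intro x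
    exact (Rad.H1_contDiff hQ (qq_pos hf0 y hd x)).comp x hq1.contDiffAt
  have hS : ∀ i, ContDiff ℝ 1 (Sf u i j) := fun i => (Sf_smooth hu i j).of_le one_le_top'
  have hb : ContDiff ℝ 1 (lap u) := (lap_smooth hu).of_le one_le_top'
  have hbi : ∀ i, ContDiff ℝ 1 (pd i (lap u)) := fun i => (pd_smooth (lap_smooth hu) i).of_le one_le_top'
  have hqi : ∀ i, ContDiff ℝ 1 (pd i (qq f u y d)) := fun i => pd_contDiff hq (by norm_num) i
  have hp := fp_contDiff hf hu j
  unfold Vf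
  exact (ContDiff.sum fun i _ => (hS i).mul ((hH.mul (hbi i)).sub (hb.mul (hH1.mul (hqi i))))).sub
    (hH.mul (hb.mul hp))

lemma pd_Vf (hf : ContDiff ℝ 2 f) (hu : ContDiff ℝ (⊤ : ℕ∞) u) (hf0 : ∀ z, 0 ≤ f z) (y : E3)
    {d Q : ℝ} (hd : 0 < d) (hQ : 0 < Q) (j : Fin 3) (x : E3) :
    pd j (Vf f u y d Q j) x =
      ∑ i, (Sf u i j x * ((Rad.H Q (qq f u y d x) * pd j (pd i (lap u)) x
          + Rad.H1 Q (qq f u y d x) * pd j (qq f u y d) x * pd i (lap u) x)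
        - (lap u x * (Rad.H1 Q (qq f u y d x) * pd j (pd i (qq f u y d)) x
            + Rad.H2 Q (qq f u y d x) * pd j (qq f u y d) x * pd i (qq f u y d) x)
          + pd j (lap u) x * (Rad.H1 Q (qq f u y d x) * pd i (qq f u y d) x)))
        + pd j (Sf u i j) x * (Rad.H Q (qq f u y d x) * pd i (lap u) x
      - lap u x * (Rad.H1 Q (qq f u y d x) * pd i (qq f u y d) x)))
      - (Rad.H Q (qq f u y d x) * (lap u x * pd j (fp f u j) x + pd j (lap u) x * fp f u j x)
        + Rad.H1 Q (qq f u y d x) * pd j (qq f u y d) x * (lap u x * fp f u j x)) := by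
  have hq := qq_contDiff hf hu y d
  have hqd : DifferentiableAt ℝ (qq f u y d) x := hq.differentiable (by norm_num) x
  have hH' := Rad.H_deriv (Q := Q) (qq_pos (u := u) hf0 y hd x)
  have hH1' := Rad.H1_deriv hQ (qq_pos (u := u) hf0 y hd x)
  have hH : DifferentiableAt ℝ (fun x => Rad.H Q (qq f u y d x)) x :=
    (hH'.comp_hasFDerivAt x hqd.hasFDerivAt).differentiableAt
  have hH1 : DifferentiableAt ℝ (fun x => Rad.H1 Q (qq f u y d x)) x :=
    (hH1'.comp_hasFDerivAt x hqd.hasFDerivAt).differentiableAt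
  have hS : ∀ i, DifferentiableAt ℝ (Sf u i j) x := fun i => pd_diff (Sf_smooth hu i j) x
  have hb : DifferentiableAt ℝ (lap u) x := pd_diff (lap_smooth hu) x
  have hbi : ∀ i, DifferentiableAt ℝ (pd i (lap u)) x := fun i => d1 (lap_smooth hu) i x
  have hqi : ∀ i, DifferentiableAt ℝ (pd i (qq f u y d)) x := fun i =>
    (pd_contDiff (m := 1) hq (by norm_num) i).differentiable (by norm_num) x
  have hp : DifferentiableAt ℝ (fp f u j) x := (fp_contDiff hf hu j).differentiable (by norm_num) x
  have h1 : ∀ i, DifferentiableAt ℝ (fun x => Sf u i j x * (Rad.H Q (qq f u y d x) * pd i (lap u) x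
      - lap u x * (Rad.H1 Q (qq f u y d x) * pd i (qq f u y d) x))) x := fun i =>
    (hS i).fun_mul ((hH.fun_mul (hbi i)).fun_sub (hb.fun_mul (hH1.fun_mul (hqi i))))
  unfold Vf
  rw [pd_sub j (DifferentiableAt.fun_sum fun i _ => h1 i) (hH.fun_mul (hb.fun_mul hp)), pd_sum j h1,
    pd_mul j hH (hb.fun_mul hp), pd_mul j hb hp, pd_comp j hqd hH']
  congr 1
  apply Finset.sum_congr rfl
  intro i _
  rw [pd_mul j (hS i) ((hH.fun_mul (hbi i)).fun_sub (hb.fun_mul (hH1.fun_mul (hqi i)))),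
    pd_sub j (hH.fun_mul (hbi i)) (hb.fun_mul (hH1.fun_mul (hqi i))), pd_mul j hH (hbi i),
    pd_mul j hb (hH1.fun_mul (hqi i)), pd_mul j hH1 (hqi i), pd_comp j hqd hH', pd_comp j hqd hH1']

lemma div_Vf (hf : ContDiff ℝ 2 f) (hu : ContDiff ℝ (⊤ : ℕ∞) u) (hf0 : ∀ z, 0 ≤ f z) (y : E3)
    {d Q : ℝ} (hd : 0 < d) (hQ : 0 < Q) (x : E3) :
    ∑ j, pd j (Vf f u y d Q j) x =
      Rad.H Q (qq f u y d x) * (∑ i, ∑ j, Sf u i j x * pd i (pd j (lap u)) x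
        - ∑ j, fp f u j x * pd j (lap u) x - lap u x * ∑ j, pd j (fp f u j) x)
      - lap u x * (Rad.H2 Q (qq f u y d x) * SQ (hess u x) (fun i => pd i (qq f u y d) x)
            (fun i => pd i (qq f u y d) x)
        + Rad.H1 Q (qq f u y d x) * ∑ i, ∑ j, Sf u i j x * pd i (pd j (qq f u y d)) x
        + Rad.H1 Q (qq f u y d x) * ∑ j, fp f u j x * pd j (qq f u y d) x) := by
  simp only [pd_Vf hf hu hf0 y hd hQ]
  have hS := Sf_symm hu
  have hD := fun i => div_Sf hu i x
  have hbc := fun i j => pd_comm ((lap_smooth hu).of_le two_le_top) i j x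
  have hqc := fun i j => pd_comm (qq_contDiff hf hu y d) i j x
  have hSQ : SQ (hess u x) (fun i => pd i (qq f u y d) x) (fun i => pd i (qq f u y d) x) =
      ∑ i, ∑ j, Sf u i j x * pd i (qq f u y d) x * pd j (qq f u y d) x := rfl
  rw [hSQ]
  generalize Rad.H Q (qq f u y d x) = H at *
  generalize Rad.H1 Q (qq f u y d x) = H1 at *
  generalize Rad.H2 Q (qq f u y d x) = H2 at *
  generalize hq : qq f u y d = q at *
  generalize hb : lap u = b at *
  simp only [Fin.sum_univ_three] at hD ⊢
  have d0 := hD 0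
  have d1 := hD 1
  have d2 := hD 2
  rw [hS 1 0 x, hS 2 0 x, hS 2 1 x, hbc 1 0, hbc 2 0, hbc 2 1, hqc 1 0, hqc 2 0, hqc 2 1]
  linear_combination (H * pd 0 b x - b x * (H1 * pd 0 q x)) * d0
    + (H * pd 1 b x - b x * (H1 * pd 1 q x)) * d1 + (H * pd 2 b x - b x * (H1 * pd 2 q x)) * d2

end


/-- the pseudo-distance -/
def rr (f : E3 × ℝ × E3 → ℝ) (u : E3 → ℝ) (y x : E3) : ℝ :=
  Real.sqrt (f (x, u x, grad u x) * ‖x - y‖ ^ 2 + ‖grad u x - grad u y‖ ^ 2)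

/-- Hypotheses after extension. -/
structure GH (K : ℝ) (f : E3 × ℝ × E3 → ℝ) (u : E3 → ℝ) (U : Set E3) : Prop where
  hK : 1 ≤ K
  hf : ContDiff ℝ 2 f
  lo : ∀ z, 1 / K ≤ f z
  bd : ∀ z, ∀ k : ℕ, k ≤ 2 → ‖iteratedFDeriv ℝ k f z‖ ≤ K
  hu : ContDiff ℝ (⊤ : ℕ∞) u
  hU : IsOpen U
  pde : ∀ x ∈ U, sigma2 (hess u x) = f (zz u x)
  pos : ∀ x ∈ U, 0 < lap u x
  gr : ∀ x ∈ U, ‖grad u x‖ ≤ K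

namespace GH
variable {K : ℝ} {f : E3 × ℝ × E3 → ℝ} {u : E3 → ℝ} {U : Set E3}

lemma K0 (h : GH K f u U) : 0 < K := by linarith [h.hK]

lemma f0 (h : GH K f u U) : ∀ z, 0 ≤ f z := fun z =>
  le_trans (by have := h.K0; positivity) (h.lo z)

lemma fK (h : GH K f u U) (z) : f z ≤ K := by
  have := h.bd z 0 (by norm_num)
  rw [norm_iteratedFDeriv_zero] at this
  exact (le_abs_self _).trans this

lemma hL (h : GH K f u U) (z) : ‖fderiv ℝ f z‖ ≤ K := by
  have := h.bd z 1 (by norm_num)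
  rwa [norm_iteratedFDeriv_one] at this

lemma hD (h : GH K f u U) (z) : ‖fderiv ℝ (fderiv ℝ f) z‖ ≤ K := by
  have := h.bd z 2 (by norm_num)
  rwa [← norm_iteratedFDeriv_fderiv, norm_iteratedFDeriv_one] at this

lemma norm_sq (v : E3) : ‖v‖ ^ 2 = ∑ i, v i * v i := by
  rw [EuclideanSpace.norm_sq_eq]
  simp [pow_two]

lemma rr_sq (h : GH K f u U) (y x : E3) : rr f u y x ^ 2 =
    f (zz u x) * (∑ i, (x i - y i) * (x i - y i)) +
      ∑ k, (pd k u x - pd k u y) * (pd k u x - pd k u y) := by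
  unfold rr
  rw [Real.sq_sqrt (add_nonneg (mul_nonneg (h.f0 _) (by positivity)) (by positivity)), norm_sq, norm_sq]
  rfl

lemma qq_eq (h : GH K f u U) (y x : E3) (d : ℝ) : qq f u y d x = rr f u y x ^ 2 + d ^ 2 := by
  rw [h.rr_sq]; rfl

lemma pw (h : GH K f u U) {x : E3} (hx : x ∈ U) : PW K (fun k => pd k u x) (hess u x) where
  hK := h.hK
  hA := hess_symm h.hu x
  lo := by rw [h.pde x hx]; exact h.lo _
  hi := by rw [h.pde x hx]; exact h.fK _
  h1 := h.pos x hx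
  hp := by
    have := h.gr x hx
    have e : ∑ i, pd i u x * pd i u x = ‖grad u x‖ ^ 2 := by rw [norm_sq]; rfl
    rw [e]
    gcongr

lemma pdd (h : GH K f u U) {x : E3} (hx : x ∈ U) (y : E3) (hr : rr f u y x ≤ 1) :
    PD K (fun k => pd k u x) (hess u x) (fderiv ℝ f (zz u x)) (fderiv ℝ (fderiv ℝ f) (zz u x))
      (TT u x) (fun i => x i - y i) (fun k => pd k u x - pd k u y) (rr f u y x) where
  pw := h.pw hx
  hL := h.hL _
  hD := h.hD _
  hT := fun k => by
    rw [← pd_F h.hf h.hu]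
    exact pde1 h.hu h.hU h.pde hx k
  r0 := Real.sqrt_nonneg _
  r1 := hr
  hr := by rw [h.rr_sq, h.pde x hx]

lemma fp_le (h : GH K f u U) (x : E3) (j : Fin 3) : |fp f u j x| ≤ K := by
  have h1 := (fderiv ℝ f (zz u x)).le_opNorm (0, 0, EuclideanSpace.single j 1)
  have h2 : ‖((0, 0, EuclideanSpace.single j 1) : E3 × ℝ × E3)‖ ≤ 1 := by
    simp [Prod.norm_def]
  calc |fp f u j x| ≤ ‖fderiv ℝ f (zz u x)‖ * ‖((0, 0, EuclideanSpace.single j 1) : E3 × ℝ × E3)‖ := h1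
    _ ≤ K * 1 := mul_le_mul (h.hL _) h2 (norm_nonneg _) h.K0.le
    _ = K := mul_one K

lemma dfp_le (h : GH K f u U) {x : E3} (hx : x ∈ U) (j : Fin 3) :
    pd j (fp f u j) x ≤ K ^ 3 * lap u x := by
  rw [pd_fp h.hf h.hu]
  have h1 := (fderiv ℝ (fderiv ℝ f) (zz u x)).le_opNorm₂ (zv (fun k => pd k u x) (hess u x) j)
    (0, 0, EuclideanSpace.single j 1)
  have h2 : ‖((0, 0, EuclideanSpace.single j 1) : E3 × ℝ × E3)‖ ≤ 1 := by
    simp [Prod.norm_def]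
  have h3 := (h.pw hx).norm_z j
  have hK := h.K0
  have hb := h.pos x hx
  rw [hess_trace] at h3
  refine (le_abs_self _).trans (h1.trans ?_)
  calc _ ≤ K * (K ^ 2 * lap u x) * 1 :=
        mul_le_mul (mul_le_mul (h.hD _) h3 (norm_nonneg _) hK.le) h2 (norm_nonneg _) (by positivity)
    _ = _ := by ring

lemma X1 (h : GH K f u U) {x : E3} (hx : x ∈ U) (y : E3) (hr : rr f u y x ≤ 1) :
    -(15 * K ^ 8 * (lap u x * WW (hess u x))) ≤ ∑ i, ∑ j, Sf u i j x * pd i (pd j (lap u)) x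
        - ∑ j, fp f u j x * pd j (lap u) x - lap u x * ∑ j, pd j (fp f u j) x := by
  have hK := h.hK
  have hb := h.pos x hx
  have hsb := pde2 h.hf h.hu h.hU h.pde hx
  have e1 : ∑ k, pd k (pd k (fun x => f (zz u x))) x =
      ∑ k, (fderiv ℝ (fderiv ℝ f) (zz u x) (zv (fun k => pd k u x) (hess u x) k)
        (zv (fun k => pd k u x) (hess u x) k))
      + fderiv ℝ f (zz u x) (0, (hess u x).trace, WithLp.toLp 2 (fun k => pd k (lap u) x)) := by
    simp only [pd_pd_F h.hf h.hu, Finset.sum_add_distrib, ← map_sum]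
    congr 2
    ext k
    · simp [Fin.sum_univ_three]
    · simp [Fin.sum_univ_three, Matrix.trace]
    · simp [Fin.sum_univ_three, pd_lap h.hu, TT]
  rw [e1] at hsb
  have := (h.pdd hx y hr).P1 (fun k => pd k (lap u) x) (fun k => pd_lap h.hu x k) _ hsb
  have e2 : ∑ l, fderiv ℝ f (zz u x) (0, 0, EuclideanSpace.single l 1) * pd l (lap u) x
    = ∑ j, fp f u j x * pd j (lap u) x := rfl
  rw [e2, hess_trace] at this
  have h3 : lap u x * ∑ j, pd j (fp f u j) x ≤ 3 * K ^ 3 * lap u x ^ 2 := by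
    have : ∑ j, pd j (fp f u j) x ≤ 3 * (K ^ 3 * lap u x) := by
      rw [Fin.sum_univ_three]
      linarith [h.dfp_le hx 0, h.dfp_le hx 1, h.dfp_le hx 2]
    have := mul_le_mul_of_nonneg_left this hb.le
    linarith
  have h4 : K ^ 3 ≤ K ^ 7 := pow_le_pow_right₀ hK (by norm_num)
  have h5 : 3 * K ^ 3 * lap u x ^ 2 ≤ 3 * K ^ 7 * lap u x ^ 2 := by gcongr
  have h6 : lap u x ≤ 3 / 2 * K * WW (hess u x) := (h.pw hx).b_le
  have h7 : 10 * K ^ 7 * lap u x * lap u x ≤ 10 * K ^ 7 * lap u x * (3 / 2 * K * WW (hess u x)) := by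
    gcongr
  linarith

lemma pd_q' (h : GH K f u U) {x : E3} (hx : x ∈ U) (y : E3) (d : ℝ) (j : Fin 3) :
    pd j (qq f u y d) x = fderiv ℝ f (zz u x) (zv (fun k => pd k u x) (hess u x) j)
      * (∑ i, (x i - y i) * (x i - y i))
      + 2 * sigma2 (hess u x) * (x j - y j) + 2 * ∑ k, (pd k u x - pd k u y) * hess u x j k := by
  rw [pd_q h.hf h.hu, pd_F h.hf h.hu, h.pde x hx]

lemma X2 (h : GH K f u U) {x : E3} (hx : x ∈ U) (y : E3) (d : ℝ) (hr : rr f u y x ≤ 1) :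
    SQ (hess u x) (fun i => pd i (qq f u y d) x) (fun i => pd i (qq f u y d) x)
      ≤ 4 * rr f u y x ^ 2 * (1 + 6 * K ^ 7 * rr f u y x) * WW (hess u x) := by
  simp only [h.pd_q' hx]
  exact (h.pdd hx y hr).P5

lemma X3 (h : GH K f u U) {x : E3} (hx : x ∈ U) (y : E3) (d : ℝ) (hr : rr f u y x ≤ 1) :
    (6 - 100 * K ^ 6 * rr f u y x) * WW (hess u x) ≤
      ∑ i, ∑ j, Sf u i j x * pd i (pd j (qq f u y d)) x := by
  simp only [pd_pd_q h.hf h.hu, pd_pd_F h.hf h.hu, pd_F h.hf h.hu, ← h.pde x hx]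
  exact (h.pdd hx y hr).P4

lemma X4 (h : GH K f u U) {x : E3} (hx : x ∈ U) (y : E3) (d : ℝ) (hr : rr f u y x ≤ 1) :
    ∑ j, fp f u j x * pd j (qq f u y d) x ≥ -(41 * K ^ 6 * rr f u y x * WW (hess u x)) := by
  simp only [h.pd_q' hx]
  exact (abs_le.1 ((h.pdd hx y hr).P3 (fun j => fp f u j x) (h.fp_le x))).1

lemma pointwise (h : GH K f u U) {x : E3} (hx : x ∈ U) (y : E3) {δ R : ℝ} (hδ : 0 < δ) (hδR : δ ≤ R)
    (hR : R ≤ 1 / (800 * (141 * K ^ 8) ^ 2)) (hr : rr f u y x ≤ R) :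
    lap u x * WW (hess u x) * ((if rr f u y x ≤ δ then 1 / (2 * δ ^ 3) else 0) - 18 / R ^ 3) ≤
      ∑ j, pd j (Vf f u y δ (R ^ 2 + δ ^ 2) j) x := by
  have hK := h.hK
  have hC : 1 ≤ 141 * K ^ 8 := by
    have : 1 ≤ K ^ 8 := one_le_pow₀ hK
    linarith
  have hR1 : R ≤ 1 := hR.trans (by
    rw [div_le_one (by positivity)]
    have : 1 ≤ (141 * K ^ 8) ^ 2 := one_le_pow₀ hC
    linarith)
  have hr1 : rr f u y x ≤ 1 := hr.trans hR1
  have r0 : 0 ≤ rr f u y x := Real.sqrt_nonneg _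
  have hQ : 0 < R ^ 2 + δ ^ 2 := by positivity
  have hq : 0 < rr f u y x ^ 2 + δ ^ 2 := by positivity
  rw [div_Vf h.hf h.hu h.f0 y hδ hQ, h.qq_eq]
  have x1 := h.X1 hx y hr1
  have x2 := h.X2 hx y δ hr1
  have x3 := h.X3 hx y δ hr1
  have x4 := h.X4 hx y δ hr1
  have m := Rad.main hC hδ hδR hR r0 hr
  have s0 := Rad.H_nonneg hQ hq
  have s1 := Rad.H1_nonpos hQ hq
  have s2 := Rad.H2_nonneg (R ^ 2 + δ ^ 2) (rr f u y x ^ 2 + δ ^ 2)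
  have hb := h.pos x hx
  have hW := (h.pw hx).W_pos
  generalize Rad.H (R ^ 2 + δ ^ 2) (rr f u y x ^ 2 + δ ^ 2) = H at *
  generalize Rad.H1 (R ^ 2 + δ ^ 2) (rr f u y x ^ 2 + δ ^ 2) = H1 at *
  generalize Rad.H2 (R ^ 2 + δ ^ 2) (rr f u y x ^ 2 + δ ^ 2) = H2 at *
  generalize rr f u y x = r at *
  generalize WW (hess u x) = W at *
  generalize (∑ i, ∑ j, Sf u i j x * pd i (pd j (lap u)) x
        - ∑ j, fp f u j x * pd j (lap u) x - lap u x * ∑ j, pd j (fp f u j) x) = Y1 at *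
  generalize SQ (hess u x) (fun i => pd i (qq f u y δ) x) (fun i => pd i (qq f u y δ) x) = Y2 at *
  generalize ∑ i, ∑ j, Sf u i j x * pd i (pd j (qq f u y δ)) x = Y3 at *
  generalize ∑ j, fp f u j x * pd j (qq f u y δ) x = Y4 at *
  generalize lap u x = b at *
  generalize ((if r ≤ δ then 1 / (2 * δ ^ 3) else 0) - 18 / R ^ 3) = M at *
  have K86 : K ^ 6 ≤ K ^ 8 := pow_le_pow_right₀ hK (by norm_num)
  have K87 : K ^ 7 ≤ K ^ 8 := pow_le_pow_right₀ hK (by norm_num)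
  have K8 : 0 ≤ K ^ 8 := by positivity
  have m' := mul_le_mul_of_nonneg_left m (mul_pos hb hW).le
  have y1 : -(141 * K ^ 8 * (b * W)) * H ≤ H * Y1 := by
    have : -(141 * K ^ 8 * (b * W)) ≤ Y1 := by
      have : 0 ≤ K ^ 8 * (b * W) := by positivity
      linarith
    have := mul_le_mul_of_nonneg_left this s0
    linarith
  have y2 : b * (H2 * Y2) ≤ b * (H2 * (4 * r ^ 2 * (1 + 141 * K ^ 8 * r) * W)) := by
    have : Y2 ≤ 4 * r ^ 2 * (1 + 141 * K ^ 8 * r) * W := by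
      refine x2.trans ?_
      have : 6 * K ^ 7 * r ≤ 141 * K ^ 8 * r := by
        apply mul_le_mul_of_nonneg_right _ r0; linarith
      gcongr
    gcongr
  have y3 : b * (H1 * (Y3 + Y4)) ≤ b * (H1 * ((6 - 141 * K ^ 8 * r) * W)) := by
    have : (6 - 141 * K ^ 8 * r) * W ≤ Y3 + Y4 := by
      have : K ^ 6 * (r * W) ≤ K ^ 8 * (r * W) := by gcongr
      linarith
    have := mul_le_mul_of_nonpos_left this s1
    gcongr
  linarith

end GH


lemma integral_pd_zero {g : E3 → ℝ} (hg : ContDiff ℝ 1 g) (hc : HasCompactSupport g) (j : Fin 3) :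
    Integrable (pd j g) ∧ ∫ x, pd j g x = 0 := by
  have h1 : Continuous (pd j g) := (pd_contDiff (m := 0) hg (by norm_num) j).continuous
  have h2 : HasCompactSupport (pd j g) := hc.fderiv_apply ℝ _
  have hi : Integrable (pd j g) := h1.integrable_of_hasCompactSupport h2
  refine ⟨hi, ?_⟩
  have hd : Differentiable ℝ g := hg.differentiable (by norm_num)
  have hi' : Integrable (fun x => fderiv ℝ g x (EuclideanSpace.single j 1)) := hi
  have := integral_mul_fderiv_eq_neg_fderiv_mul_of_integrable (μ := (volume : Measure E3))
    (f := fun _ => (1 : ℝ)) (g := g) (v := EuclideanSpace.single j 1)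
    (by simp) (by simpa using hi')
    (by simpa using hg.continuous.integrable_of_hasCompactSupport hc)
    (fun x _ => by fun_prop) (fun x _ => hd x)
  simpa [pd] using this

namespace GH
variable {K : ℝ} {f : E3 × ℝ × E3 → ℝ} {u : E3 → ℝ} {U : Set E3}

/-- the density -/
def wd (u : E3 → ℝ) (x : E3) : ℝ := lap u x * WW (hess u x)

lemma wd_cont (hu : ContDiff ℝ (⊤ : ℕ∞) u) : Continuous (wd u) := by
  have h2 : ∀ i j, Continuous (pd i (pd j u)) := fun i j => (pd_smooth (pd_smooth hu j) i).continuous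
  have hh : Continuous (hess u) := by
    refine continuous_matrix fun i j => ?_
    exact h2 i j
  have hl := (lap_smooth hu).continuous
  unfold wd WW sigma2
  fun_prop

lemma rr_cont (h : GH K f u U) (y : E3) : Continuous (rr f u y) := by
  have h1 : Continuous (fun x => f (zz u x)) := (F_contDiff h.hf h.hu).continuous
  have h2 := (grad_contDiff h.hu).continuous
  have h3 : Continuous (fun x => Real.sqrt (f (zz u x) * ‖x - y‖ ^ 2 + ‖grad u x - grad u y‖ ^ 2)) :=
    Real.continuous_sqrt.comp ((h1.mul ((continuous_id.sub continuous_const).norm.pow 2)).add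
      ((h2.sub continuous_const).norm.pow 2))
  exact h3

lemma dist_le (h : GH K f u U) (y x : E3) : ‖x - y‖ ≤ Real.sqrt K * rr f u y x := by
  have hK := h.K0
  unfold rr
  rw [← Real.sqrt_mul hK.le]
  apply Real.le_sqrt_of_sq_le
  have : 1 / K * ‖x - y‖ ^ 2 ≤ f (x, u x, grad u x) * ‖x - y‖ ^ 2 := by
    gcongr; exact h.lo _
  calc ‖x - y‖ ^ 2 = K * (1 / K * ‖x - y‖ ^ 2) := by field_simp
    _ ≤ K * (f (x, u x, grad u x) * ‖x - y‖ ^ 2 + ‖grad u x - grad u y‖ ^ 2) := by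
      gcongr
      nlinarith [sq_nonneg ‖grad u x - grad u y‖]

lemma compact (h : GH K f u U) (y : E3) (R : ℝ) : IsCompact {x | rr f u y x ≤ R} := by
  apply (isCompact_closedBall y (Real.sqrt K * R)).of_isClosed_subset
    (isClosed_le (h.rr_cont y) continuous_const)
  intro x hx
  rw [mem_closedBall, dist_eq_norm]
  exact (h.dist_le y x).trans (mul_le_mul_of_nonneg_left hx (Real.sqrt_nonneg _))

lemma wd_nonneg (h : GH K f u U) {x : E3} (hx : x ∈ U) : 0 ≤ wd u x :=
  mul_nonneg (h.pos x hx).le (h.pw hx).W_pos.le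

lemma int_on (h : GH K f u U) (y : E3) (R : ℝ) : IntegrableOn (wd u) {x | rr f u y x ≤ R} :=
  (wd_cont h.hu).continuousOn.integrableOn_compact (h.compact y R)

lemma small (h : GH K f u U) (y : E3) {δ R : ℝ} (hδ : 0 < δ) (hδR : δ ≤ R)
    (hR : R ≤ 1 / (800 * (141 * K ^ 8) ^ 2)) (hs : ∀ x, rr f u y x ≤ R → x ∈ U) :
    (∫ x in {x | rr f u y x ≤ δ}, wd u x) / δ ^ 3 ≤
      36 * ((∫ x in {x | rr f u y x ≤ R}, wd u x) / R ^ 3) := by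
  have hR0 : 0 < R := hδ.trans_le hδR
  set Q := R ^ 2 + δ ^ 2 with hQd
  have hQ : 0 < Q := by positivity
  have mS : ∀ ρ, MeasurableSet {x | rr f u y x ≤ ρ} := fun ρ => (h.compact y ρ).isClosed.measurableSet
  have hz : ∀ x, ¬ rr f u y x ≤ R → Q ≤ qq f u y δ x := by
    intro x hx
    rw [h.qq_eq, hQd]
    push Not at hx
    gcongr
  have hsupp : ∀ j, HasCompactSupport (Vf f u y δ Q j) := fun j => by
    apply HasCompactSupport.intro (h.compact y R)
    intro x hx
    obtain ⟨h1, h2, _⟩ := Rad.H_zero hQ (hz x hx)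
    simp [Vf, h1, h2]
  have hV := fun j => integral_pd_zero (Vf_contDiff h.hf h.hu h.f0 y hδ hQ j) (hsupp j) j
  have hI : Integrable (fun x => ∑ j, pd j (Vf f u y δ Q j) x) :=
    integrable_finsetSum _ fun j _ => (hV j).1
  have hI0 : ∫ x, ∑ j, pd j (Vf f u y δ Q j) x = 0 := by
    rw [integral_finsetSum _ fun j _ => (hV j).1]
    simp [fun j => (hV j).2]
  have i1 : Integrable ({x | rr f u y x ≤ δ}.indicator (wd u)) :=
    (integrable_indicator_iff (mS δ)).2 (h.int_on y δ)
  have i2 : Integrable ({x | rr f u y x ≤ R}.indicator (wd u)) :=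
    (integrable_indicator_iff (mS R)).2 (h.int_on y R)
  have key : ∫ x, (1 / (2 * δ ^ 3) * {x | rr f u y x ≤ δ}.indicator (wd u) x
      - 18 / R ^ 3 * {x | rr f u y x ≤ R}.indicator (wd u) x) ≤ ∫ x, ∑ j, pd j (Vf f u y δ Q j) x := by
    apply integral_mono ((i1.const_mul _).sub (i2.const_mul _)) hI
    intro x
    change 1 / (2 * δ ^ 3) * {x | rr f u y x ≤ δ}.indicator (wd u) x
      - 18 / R ^ 3 * {x | rr f u y x ≤ R}.indicator (wd u) x ≤ ∑ j, pd j (Vf f u y δ Q j) x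
    by_cases hx : rr f u y x ≤ R
    · have := h.pointwise (hs x hx) y hδ hδR hR hx
      refine le_trans (le_of_eq ?_) this
      simp only [Set.indicator, Set.mem_ofPred_eq, hx, if_true, wd]
      split_ifs <;> ring
    · have hx2 : ¬ rr f u y x ≤ δ := fun hc => hx (hc.trans hδR)
      obtain ⟨h1, h2, h3⟩ := Rad.H_zero hQ (hz x hx)
      simp only [Set.indicator, Set.mem_ofPred_eq, hx, hx2, if_false]
      rw [div_Vf h.hf h.hu h.f0 y hδ hQ, h1, h2, h3]
      simp
  rw [hI0, integral_sub (i1.const_mul _) (i2.const_mul _), integral_const_mul, integral_const_mul,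
    integral_indicator (mS δ), integral_indicator (mS R)] at key
  have e1 : 1 / (2 * δ ^ 3) * (∫ x in {x | rr f u y x ≤ δ}, wd u x) =
    (∫ x in {x | rr f u y x ≤ δ}, wd u x) / δ ^ 3 / 2 := by field_simp
  have e2 : 18 / R ^ 3 * (∫ x in {x | rr f u y x ≤ R}, wd u x) =
    18 * ((∫ x in {x | rr f u y x ≤ R}, wd u x) / R ^ 3) := by ring
  rw [e1, e2] at key
  linarith

lemma mono (h : GH K f u U) (y : E3) {δ R : ℝ} (hδR : δ ≤ R) (hs : ∀ x, rr f u y x ≤ R → x ∈ U) :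
    (∫ x in {x | rr f u y x ≤ δ}, wd u x) ≤ (∫ x in {x | rr f u y x ≤ R}, wd u x) := by
  apply setIntegral_mono_set (h.int_on y R)
  · filter_upwards [ae_restrict_mem (h.compact y R).isClosed.measurableSet] with x hx
    exact h.wd_nonneg (hs x hx)
  · exact Filter.Eventually.of_forall fun x hx => le_trans hx hδR

lemma int_nonneg (h : GH K f u U) (y : E3) {R : ℝ} (hs : ∀ x, rr f u y x ≤ R → x ∈ U) :
    0 ≤ (∫ x in {x | rr f u y x ≤ R}, wd u x) :=
  setIntegral_nonneg (h.compact y R).isClosed.measurableSet fun x hx => h.wd_nonneg (hs x hx)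

lemma full (h : GH K f u U) (y : E3) {δ R : ℝ} (hδ : 0 < δ) (hδR : δ ≤ R)
    (hR : R ≤ 9) (hs : ∀ x, rr f u y x ≤ R → x ∈ U) :
    (∫ x in {x | rr f u y x ≤ δ}, wd u x) / δ ^ 3 ≤
      (36 * (9 * (800 * (141 * K ^ 8) ^ 2)) ^ 3) *
        ((∫ x in {x | rr f u y x ≤ R}, wd u x) / R ^ 3) := by
  have hK := h.hK
  have hR0 : 0 < R := hδ.trans_le hδR
  set N := 800 * (141 * K ^ 8) ^ 2 with hN
  have hN1 : 1 ≤ N := by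
    have : 1 ≤ K ^ 8 := one_le_pow₀ hK
    have : 1 ≤ (141 * K ^ 8) ^ 2 := one_le_pow₀ (by linarith)
    linarith
  have hI := h.int_nonneg y hs
  set I := (∫ x in {x | rr f u y x ≤ R}, wd u x) with hId
  have hIR : 0 ≤ I / R ^ 3 := by positivity
  by_cases c1 : R ≤ 1 / N
  · refine (h.small y hδ hδR c1 hs).trans ?_
    apply mul_le_mul_of_nonneg_right _ hIR
    have : 1 ≤ (9 * N) ^ 3 := one_le_pow₀ (by linarith)
    linarith
  push Not at c1
  have fin : 36 * N ^ 3 * I ≤ 36 * (9 * N) ^ 3 * (I / R ^ 3) := by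
    have : I = R ^ 3 * (I / R ^ 3) := by field_simp
    calc 36 * N ^ 3 * I = 36 * N ^ 3 * (R ^ 3 * (I / R ^ 3)) := by rw [← this]
      _ ≤ 36 * N ^ 3 * (9 ^ 3 * (I / R ^ 3)) := by gcongr
      _ = _ := by ring
  refine le_trans ?_ fin
  by_cases c2 : δ ≤ 1 / N
  · have h1 := h.small y hδ c2 le_rfl (fun x hx => hs x (hx.trans c1.le))
    refine h1.trans ?_
    have h2 := h.mono y c1.le hs
    have e : 36 * ((∫ x in {x | rr f u y x ≤ 1 / N}, wd u x) / (1 / N) ^ 3) =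
      36 * N ^ 3 * (∫ x in {x | rr f u y x ≤ 1 / N}, wd u x) := by
      generalize (∫ x in {x | rr f u y x ≤ 1 / N}, wd u x) = J
      field_simp
    rw [e]
    gcongr
  · push Not at c2
    have h2 := h.mono y hδR hs
    rw [div_le_iff₀ (by positivity)]
    refine h2.trans ?_
    have h3 : 1 ≤ N * δ := by rw [div_lt_iff₀ (by positivity)] at c2; linarith
    have h4 : 1 ≤ (N * δ) ^ 3 := one_le_pow₀ h3
    calc I ≤ 36 * I * 1 := by linarith
      _ ≤ 36 * I * (N * δ) ^ 3 := by gcongr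
      _ = _ := by ring

end GH


lemma rr_dist {K : ℝ} {f : E3 × ℝ × E3 → ℝ} (hK : 1 ≤ K) (lo : ∀ z, 1 / K ≤ f z) (u : E3 → ℝ)
    (y x : E3) : ‖x - y‖ ≤ Real.sqrt K * rr f u y x := by
  have hK : 0 < K := by linarith
  unfold rr
  rw [← Real.sqrt_mul hK.le]
  apply Real.le_sqrt_of_sq_le
  have : 1 / K * ‖x - y‖ ^ 2 ≤ f (x, u x, grad u x) * ‖x - y‖ ^ 2 := by
    gcongr; exact lo _
  calc ‖x - y‖ ^ 2 = K * (1 / K * ‖x - y‖ ^ 2) := by field_simp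
    _ ≤ K * (f (x, u x, grad u x) * ‖x - y‖ ^ 2 + ‖grad u x - grad u y‖ ^ 2) := by
      gcongr
      nlinarith [sq_nonneg ‖grad u x - grad u y‖]

lemma extend {u : E3 → ℝ} (hu : ContDiffOn ℝ (⊤ : ℕ∞) u (ball (0 : E3) 10)) {ρ : ℝ} (h0 : 0 < ρ)
    (h1 : ρ < 10) : ∃ v : E3 → ℝ, ContDiff ℝ (⊤ : ℕ∞) v ∧ ∀ x ∈ ball (0 : E3) ρ, v x = u x := by
  let χ : ContDiffBump (0 : E3) := ⟨ρ, (ρ + 10) / 2, h0, by linarith⟩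
  refine ⟨fun x => χ x * u x, ?_, ?_⟩
  · rw [contDiff_iff_contDiffAt]
    intro x
    by_cases hx : x ∈ ball (0 : E3) 10
    · exact χ.contDiff.contDiffAt.mul (hu.contDiffAt (isOpen_ball.mem_nhds hx))
    · have hx' : x ∉ tsupport χ := by
        rw [χ.tsupport_eq]
        intro hc
        apply hx
        rw [mem_closedBall] at hc
        rw [mem_ball]
        change dist x 0 ≤ (ρ + 10) / 2 at hc
        linarith
      have : (fun x => χ x * u x) =ᶠ[nhds x] fun _ => 0 := by
        filter_upwards [notMem_tsupport_iff_eventuallyEq.1 hx'] with z hz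
        rw [hz]; simp
      exact contDiffAt_const.congr_of_eventuallyEq this
  · intro x hx
    have : χ x = 1 := χ.one_of_mem_closedBall (ball_subset_closedBall hx)
    simp [this]

theorem main_thm :
    ∀ K : ℝ, 1 ≤ K → ∃ C : ℝ, 0 < C ∧
      ∀ (f : E3 × ℝ × E3 → ℝ) (u : E3 → ℝ), Hyp K f u →
        ∀ y₀ ∈ ball (0 : E3) 1, ∀ δ R : ℝ, 0 < δ → δ ≤ R → R ≤ 9 / Real.sqrt K →
          (∫ x in {x ∈ ball (0 : E3) 10 |
              Real.sqrt (f (x, u x, grad u x) * ‖x - y₀‖ ^ 2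
                + ‖grad u x - grad u y₀‖ ^ 2) ≤ δ},
            lap u x * (f (x, u x, grad u x) * lap u x - (hess u x).det)) / δ ^ 3
          ≤ C * ((∫ x in {x ∈ ball (0 : E3) 10 |
              Real.sqrt (f (x, u x, grad u x) * ‖x - y₀‖ ^ 2
                + ‖grad u x - grad u y₀‖ ^ 2) ≤ R},
            lap u x * (f (x, u x, grad u x) * lap u x - (hess u x).det)) / R ^ 3) := by
  intro K hK
  refine ⟨36 * (9 * (800 * (141 * K ^ 8) ^ 2)) ^ 3, by positivity, ?_⟩
  rintro f u ⟨hf, lo, bd, hu, pde, pos, gr⟩ y hy δ R hδ hδR hR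
  have hy1 : ‖y‖ < 1 := by simpa using hy
  have hsK : 1 ≤ Real.sqrt K := Real.one_le_sqrt.2 hK
  have hR' : Real.sqrt K * R ≤ 9 := by
    rw [le_div_iff₀ (by positivity)] at hR; linarith
  have hR0 : 0 < R := hδ.trans_le hδR
  have hR9 : R ≤ 9 := by nlinarith
  set ρ := (19 + ‖y‖) / 2 with hρ
  have n0 := norm_nonneg y
  have hρ10 : ρ < 10 := by linarith
  obtain ⟨v, hv, hvu⟩ := extend hu (ρ := ρ) (by linarith) hρ10
  set U := ball (0 : E3) ρ with hUd
  have hU : IsOpen U := isOpen_ball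
  have hsub : U ⊆ ball (0 : E3) 10 := ball_subset_ball hρ10.le
  have a1 : ∀ i, ∀ x ∈ U, pd i v x = pd i u x := fun i x hx => pd_congr i hU hvu hx
  have a2 : ∀ i j, ∀ x ∈ U, pd i (pd j v) x = pd i (pd j u) x :=
    fun i j x hx => pd_congr i hU (a1 j) hx
  have ag : ∀ x ∈ U, grad v x = grad u x := fun x hx => by
    unfold grad; simp only [a1 _ x hx]
  have ah : ∀ x ∈ U, hess v x = hess u x := fun x hx => by
    unfold hess; simp only [a2 _ _ x hx]
  have al : ∀ x ∈ U, lap v x = lap u x := fun x hx => by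
    unfold lap; simp only [ah x hx]
  have az : ∀ x ∈ U, zz v x = (x, u x, grad u x) := fun x hx => by
    unfold zz; rw [hvu x hx, ag x hx]
  have hyU : y ∈ U := by
    rw [hUd, mem_ball, dist_zero_right]; linarith
  have ar : ∀ x ∈ U, rr f v y x = rr f u y x := fun x hx => by
    unfold rr; rw [hvu x hx, ag x hx, ag y hyU]
  have G : GH K f v U :=
    { hK := hK, hf := hf, lo := lo, bd := bd, hu := hv, hU := hU
      pde := fun x hx => by rw [ah x hx, az x hx, pde x (hsub hx)]
      pos := fun x hx => by rw [al x hx]; exact pos x (hsub hx)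
      gr := fun x hx => by
        rw [ag x hx]
        have := gr x (hsub hx)
        linarith [abs_nonneg (u x)] }
  have inU : ∀ w : E3 → ℝ, ∀ x, rr f w y x ≤ R → x ∈ U := by
    intro w x hx
    have h1 := rr_dist hK lo w y x
    have h2 : Real.sqrt K * rr f w y x ≤ Real.sqrt K * R := by gcongr
    have h3 : ‖x‖ ≤ ‖x - y‖ + ‖y‖ := by simpa using norm_add_le (x - y) y
    rw [hUd, mem_ball, dist_zero_right]
    linarith
  have eqI : ∀ s, s ≤ R → (∫ x in {x ∈ ball (0 : E3) 10 |
              Real.sqrt (f (x, u x, grad u x) * ‖x - y‖ ^ 2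
                + ‖grad u x - grad u y‖ ^ 2) ≤ s},
            lap u x * (f (x, u x, grad u x) * lap u x - (hess u x).det))
      = ∫ x in {x | rr f v y x ≤ s}, GH.wd v x := by
    intro s hs
    have eS : {x ∈ ball (0 : E3) 10 | Real.sqrt (f (x, u x, grad u x) * ‖x - y‖ ^ 2
                + ‖grad u x - grad u y‖ ^ 2) ≤ s} = {x | rr f v y x ≤ s} := by
      ext x
      constructor
      · rintro ⟨_, h2⟩
        have h3 : rr f u y x ≤ s := h2
        change rr f v y x ≤ s
        rw [ar x (inU u x (h3.trans hs))]; exact h3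
      · intro h2
        have h3 : rr f v y x ≤ s := h2
        have hx := inU v x (h3.trans hs)
        refine ⟨hsub hx, ?_⟩
        change rr f u y x ≤ s
        rw [← ar x hx]; exact h3
    rw [eS]
    apply setIntegral_congr_fun (G.compact y s).isClosed.measurableSet
    intro x hx
    have h3 : rr f v y x ≤ s := hx
    have hx := inU v x (h3.trans hs)
    simp only [GH.wd, WW]
    rw [G.pde x hx, az x hx, al x hx, ah x hx, hess_trace]
  rw [eqI δ hδR, eqI R le_rfl]
  exact G.full y hδ hδR hR9 (inU v)


/-- Monotonicity formula: with `r(x)² = F(x)|x−y₀|² + |Du(x)−Du(y₀)|²` and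
`𝔅_ρ = {x ∈ B₁₀ : r(x) ≤ ρ}`, for `0 < δ ≤ R ≤ 9/√K` one has
`δ⁻³ ∫_{𝔅_δ} Δu·(F·Δu − σ₃) ≤ C R⁻³ ∫_{𝔅_R} Δu·(F·Δu − σ₃)`. -/
theorem stmt_11 :
    ∀ K : ℝ, 1 ≤ K → ∃ C : ℝ, 0 < C ∧
      ∀ (f : E3 × ℝ × E3 → ℝ) (u : E3 → ℝ), Hyp K f u →
        ∀ y₀ ∈ ball (0 : E3) 1, ∀ δ R : ℝ, 0 < δ → δ ≤ R → R ≤ 9 / Real.sqrt K →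
          (∫ x in {x ∈ ball (0 : E3) 10 |
              Real.sqrt (f (x, u x, grad u x) * ‖x - y₀‖ ^ 2
                + ‖grad u x - grad u y₀‖ ^ 2) ≤ δ},
            lap u x * (f (x, u x, grad u x) * lap u x - (hess u x).det)) / δ ^ 3
          ≤ C * ((∫ x in {x ∈ ball (0 : E3) 10 |
              Real.sqrt (f (x, u x, grad u x) * ‖x - y₀‖ ^ 2
                + ‖grad u x - grad u y₀‖ ^ 2) ≤ R},
            lap u x * (f (x, u x, grad u x) * lap u x - (hess u x).det)) / R ^ 3) := by
  exact main_thm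
end
end

section
/- For every K ≥ 1 there exists C > 0 depending only on K such that: for all real numbers λ₁ ≥ λ₂ ≥ λ₃ with σ₁(λ) > 0 and 1/K ≤ σ₂(λ) ≤ K, one has λ₁·λ₂ ≤ C·(σ₂(λ)·σ₁(λ) − σ₃(λ)). -/
/-- For ordered `λ` with `σ₁ > 0` and `1/K ≤ σ₂ ≤ K`:
`λ₁λ₂ ≤ C(σ₂σ₁ − σ₃)` with `C = C(K)`. -/
theorem stmt_15 :
    ∀ K : ℝ, 1 ≤ K → ∃ C : ℝ, 0 < C ∧
      ∀ l1 l2 l3 : ℝ, l2 ≤ l1 → l3 ≤ l2 →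
        0 < l1 + l2 + l3 →
        1 / K ≤ l1 * l2 + l1 * l3 + l2 * l3 →
        l1 * l2 + l1 * l3 + l2 * l3 ≤ K →
        l1 * l2 ≤ C * ((l1 * l2 + l1 * l3 + l2 * l3) * (l1 + l2 + l3) - l1 * l2 * l3) := by
  intro K hK
  refine ⟨K, by linarith, ?_⟩
  intro a b c hab hbc h1 h2 _
  have hK0 : 0 < K := by linarith
  have hs : 0 < a * b + a * c + b * c := lt_of_lt_of_le (by positivity) h2
  have hKs : 1 ≤ K * (a * b + a * c + b * c) := by
    have := mul_le_mul_of_nonneg_left h2 hK0.le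
    rwa [mul_one_div_cancel hK0.ne'] at this
  have hp : 0 < a + b := by
    refine pos_of_mul_pos_right (a := a + b + c) ?_ h1.le
    nlinarith [sq_nonneg (a + b), sq_nonneg a, sq_nonneg b]
  have hq : 0 < b + c := by
    refine pos_of_mul_pos_right (a := a + b + c) ?_ h1.le
    nlinarith [sq_nonneg (b + c), sq_nonneg b, sq_nonneg c]
  have hb : 0 < b := by linarith
  have ha : 0 < a := by linarith
  have e : ((a * b + a * c + b * c) * (a + b + c) - a * b * c) * (a + b)
      = ((a * b + a * c + b * c) + a ^ 2) * ((a * b + a * c + b * c) + b ^ 2) := by ring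
  generalize a * b + a * c + b * c = s at *
  have k1 : 2 * b ≤ K * (s + b ^ 2) := by
    nlinarith [sq_nonneg (b - 1), mul_nonneg (sub_nonneg.2 hK) (sq_nonneg b)]
  refine le_of_mul_le_mul_right ?_ hp
  calc a * b * (a + b) ≤ a ^ 2 * (2 * b) := by
        nlinarith [mul_nonneg (mul_pos ha hb).le (sub_nonneg.2 hab)]
    _ ≤ a ^ 2 * (K * (s + b ^ 2)) := by gcongr
    _ ≤ (s + a ^ 2) * (K * (s + b ^ 2)) := by gcongr; linarith
    _ = K * (s * (a + b + c) - a * b * c) * (a + b) := by rw [mul_assoc K, e]; ring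
end

section
/- Let λ₁ ≥ λ₂ ≥ λ₃ be real numbers with σ₁(λ) > 0, σ₂(λ) > 0 and λ₃ ≤ 0. Then σ₂(λ)·σ₁(λ) − σ₃(λ) ≥ 2·√(σ₂(λ))·λ₁·(−λ₃) ≥ 2·√(σ₂(λ))·λ₂·(−λ₃). -/
/-- For ordered `λ ∈ Γ₂ ⊂ ℝ³` with `λ₃ ≤ 0`:
`σ₂σ₁ − σ₃ ≥ 2√σ₂ · λ₁ · (−λ₃) ≥ 2√σ₂ · λ₂ · (−λ₃)`. -/
theorem stmt_16 (l1 l2 l3 : ℝ) (h12 : l2 ≤ l1) (h23 : l3 ≤ l2)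
    (hs1 : 0 < l1 + l2 + l3) (hs2 : 0 < l1 * l2 + l1 * l3 + l2 * l3) (h3 : l3 ≤ 0) :
    (l1 * l2 + l1 * l3 + l2 * l3) * (l1 + l2 + l3) - l1 * l2 * l3 ≥
        2 * Real.sqrt (l1 * l2 + l1 * l3 + l2 * l3) * l1 * (-l3) ∧
      2 * Real.sqrt (l1 * l2 + l1 * l3 + l2 * l3) * l1 * (-l3) ≥
        2 * Real.sqrt (l1 * l2 + l1 * l3 + l2 * l3) * l2 * (-l3) := by
  have ha : 0 < l1 := by linarith
  have hab : 0 < l1 * l2 := by nlinarith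
  have hb : 0 < l2 := by
    by_contra h
    nlinarith
  have hsq := Real.sq_sqrt hs2.le
  have hs := Real.sqrt_nonneg (l1 * l2 + l1 * l3 + l2 * l3)
  set s := Real.sqrt (l1 * l2 + l1 * l3 + l2 * l3)
  have hc : 0 ≤ -l3 := by linarith
  have hsc : 0 ≤ s * (-l3) := mul_nonneg hs hc
  constructor
  · have e : (l1 * l2 + l1 * l3 + l2 * l3) * (l1 + l2 + l3) - l1 * l2 * l3
        = (l1 + l2) * (s ^ 2 + l3 ^ 2) := by
      rw [hsq]; ring
    rw [e]
    have h1 : 0 ≤ (l1 + l2) * (s + l3) ^ 2 := by positivity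
    have h2 : 0 ≤ s * (-l3) * l2 := mul_nonneg hsc hb.le
    nlinarith
  · have h2 : 0 ≤ s * (-l3) * (l1 - l2) := mul_nonneg hsc (by linarith)
    nlinarith
end

section
/- For every K ≥ 1 the following holds. Assume f : ℝ³ × ℝ × ℝ³ → ℝ is of class C² with f ≥ 1/K everywhere and with |f| and all partial derivatives of f up to order 2 bounded by K; u : ℝ³ → ℝ is C^∞ on B₁₀ with σ₂(D²u(x)) = f(x, u(x), Du(x)) and Δu(x) > 0 on B₁₀; and |u(x)| + |Du(x)| ≤ K on B₁₀. Set F(x) := f(x, u(x), Du(x)). Then at every x ∈ B₁₀: Σ_{i,j} σ₂^{ij}(x) ∂_i∂_j(Δu)(x) ≥ ΔF(x) − |DF(x)|²/(2F(x)). -/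
open Metric MeasureTheory Real

noncomputable section

def Sm (v : E3 → ℝ) : Prop := ContDiffOn ℝ (⊤ : ℕ∞) v (ball (0 : E3) 10)

lemma Sm.diff {v : E3 → ℝ} (h : Sm v) {x : E3} (hx : x ∈ ball (0 : E3) 10) :
    DifferentiableAt ℝ v x :=
  (ContDiffOn.contDiffAt h (isOpen_ball.mem_nhds hx)).differentiableAt (by simp)

lemma Sm.pd {v : E3 → ℝ} (h : Sm v) (i : Fin 3) : Sm (pd i v) := by
  unfold Sm _root_.pd
  have h1 : ContDiffOn ℝ (⊤ : ℕ∞) (fderiv ℝ v) (ball (0 : E3) 10) :=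
    ContDiffOn.fderiv_of_isOpen h isOpen_ball (by norm_cast)
  exact h1.clm_apply contDiffOn_const

lemma Sm.add {v w : E3 → ℝ} (h : Sm v) (h' : Sm w) : Sm (fun y => v y + w y) :=
  ContDiffOn.add h h'

lemma Sm.mul {v w : E3 → ℝ} (h : Sm v) (h' : Sm w) : Sm (fun y => v y * w y) :=
  ContDiffOn.mul h h'

lemma Sm.sub {v w : E3 → ℝ} (h : Sm v) (h' : Sm w) : Sm (fun y => v y - w y) :=
  ContDiffOn.sub h h'

lemma pd_congr' {v w : E3 → ℝ} (h : ∀ x ∈ ball (0 : E3) 10, v x = w x) (i : Fin 3) :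
    ∀ x ∈ ball (0 : E3) 10, pd i v x = pd i w x := by
  intro x hx
  have : v =ᶠ[nhds x] w := by
    filter_upwards [isOpen_ball.mem_nhds hx] with y hy using h y hy
  unfold pd
  rw [this.fderiv_eq]

lemma pd_comm'_s18 {v : E3 → ℝ} (h : Sm v) (i j : Fin 3) :
    ∀ x ∈ ball (0 : E3) 10, pd i (pd j v) x = pd j (pd i v) x := by
  intro x hx
  have hc : ContDiffAt ℝ (⊤ : ℕ∞) v x := ContDiffOn.contDiffAt h (isOpen_ball.mem_nhds hx)
  have hs : IsSymmSndFDerivAt ℝ v x :=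
    (hc.of_le (m := 2) (by norm_cast)).isSymmSndFDerivAt (by simp)
  have hd : DifferentiableAt ℝ (fderiv ℝ v) x :=
    (hc.fderiv_right (m := 1) (by norm_cast)).differentiableAt (by simp)
  have key : ∀ a b : Fin 3, pd a (pd b v) x =
      fderiv ℝ (fderiv ℝ v) x (EuclideanSpace.single a 1) (EuclideanSpace.single b 1) := by
    intro a b
    unfold pd
    rw [fderiv_clm_apply hd (by fun_prop)]
    simp
  rw [key, key]
  exact hs _ _

lemma pd_add' {v w : E3 → ℝ} (h : Sm v) (h' : Sm w) (i : Fin 3) :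
    ∀ x ∈ ball (0 : E3) 10, pd i (fun y => v y + w y) x = pd i v x + pd i w x := by
  intro x hx
  unfold pd
  rw [fderiv_fun_add (h.diff hx) (h'.diff hx)]; rfl

lemma pd_sub' {v w : E3 → ℝ} (h : Sm v) (h' : Sm w) (i : Fin 3) :
    ∀ x ∈ ball (0 : E3) 10, pd i (fun y => v y - w y) x = pd i v x - pd i w x := by
  intro x hx
  unfold pd
  rw [fderiv_fun_sub (h.diff hx) (h'.diff hx)]; rfl

lemma pd_mul' {v w : E3 → ℝ} (h : Sm v) (h' : Sm w) (i : Fin 3) :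
    ∀ x ∈ ball (0 : E3) 10, pd i (fun y => v y * w y) x = v x * pd i w x + w x * pd i v x := by
  intro x hx
  unfold pd
  rw [fderiv_fun_mul (h.diff hx) (h'.diff hx)]; rfl

lemma pd2_add {v w : E3 → ℝ} (h : Sm v) (h' : Sm w) (i j : Fin 3) :
    ∀ x ∈ ball (0 : E3) 10, pd i (pd j (fun y => v y + w y)) x
      = pd i (pd j v) x + pd i (pd j w) x := by
  intro x hx
  rw [pd_congr' (pd_add' h h' j) i x hx, pd_add' (h.pd j) (h'.pd j) i x hx]

lemma pd2_sub {v w : E3 → ℝ} (h : Sm v) (h' : Sm w) (i j : Fin 3) :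
    ∀ x ∈ ball (0 : E3) 10, pd i (pd j (fun y => v y - w y)) x
      = pd i (pd j v) x - pd i (pd j w) x := by
  intro x hx
  rw [pd_congr' (pd_sub' h h' j) i x hx, pd_sub' (h.pd j) (h'.pd j) i x hx]

lemma pd2_mul {v w : E3 → ℝ} (h : Sm v) (h' : Sm w) (i : Fin 3) :
    ∀ x ∈ ball (0 : E3) 10, pd i (pd i (fun y => v y * w y)) x
      = v x * pd i (pd i w) x + 2 * (pd i v x * pd i w x) + w x * pd i (pd i v) x := by
  intro x hx
  rw [pd_congr' (pd_mul' h h' i) i x hx, pd_add' (h.mul (h'.pd i)) (h'.mul (h.pd i)) i x hx,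
    pd_mul' h (h'.pd i) i x hx, pd_mul' h' (h.pd i) i x hx]
  ring

/-- fourth order commutation -/
lemma pd4_comm {v : E3 → ℝ} (h : Sm v) (i j k : Fin 3) :
    ∀ x ∈ ball (0 : E3) 10, pd i (pd j (pd k (pd k v))) x = pd k (pd k (pd i (pd j v))) x := by
  have a : ∀ {w : E3 → ℝ}, Sm w → ∀ x ∈ ball (0 : E3) 10,
      pd i (pd j (pd k w)) x = pd k (pd i (pd j w)) x := by
    intro w hw x hx
    rw [pd_congr' (pd_comm'_s18 hw j k) i x hx, pd_comm'_s18 (hw.pd j) i k x hx]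
  intro x hx
  rw [a (h.pd k) x hx, pd_congr' (a h) k x hx]

/-- The reversed Cauchy-Schwarz inequality for σ₂. -/
lemma garding (a b c d e f a' b' c' d' e' f' : ℝ) (ht : 0 < a + b + c)
    (hp : 0 < a*b + a*c + b*c - d*d - e*e - f*f) :
    2 * (a'*b' + a'*c' + b'*c' - d'*d' - e'*e' - f'*f') ≤
      (a*b' + b*a' + (a*c' + c*a') + (b*c' + c*b') - (d*d' + d*d') - (e*e' + e*e')
        - (f*f' + f*f')) ^ 2 / (2 * (a*b + a*c + b*c - d*d - e*e - f*f)) := by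
  rw [le_div_iff₀ (by positivity)]
  obtain ⟨s, hs⟩ : ∃ s : ℝ, s * (a + b + c) = a' + b' + c' :=
    ⟨(a' + b' + c') / (a + b + c), by field_simp⟩
  obtain ⟨A, rfl⟩ : ∃ A, a' = A + s * a := ⟨a' - s * a, by ring⟩
  obtain ⟨B, rfl⟩ : ∃ A, b' = A + s * b := ⟨b' - s * b, by ring⟩
  obtain ⟨C, rfl⟩ : ∃ A, c' = A + s * c := ⟨c' - s * c, by ring⟩
  obtain ⟨D, rfl⟩ : ∃ A, d' = A + s * d := ⟨d' - s * d, by ring⟩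
  obtain ⟨E, rfl⟩ : ∃ A, e' = A + s * e := ⟨e' - s * e, by ring⟩
  obtain ⟨F, rfl⟩ : ∃ A, f' = A + s * f := ⟨f' - s * f, by ring⟩
  have h0 : C = - A - B := by linarith
  subst h0
  have hn : 0 ≤ -(A*B + A*(-A-B) + B*(-A-B) - D*D - E*E - F*F) := by
    nlinarith [sq_nonneg (A + B), sq_nonneg A, sq_nonneg B, sq_nonneg D, sq_nonneg E, sq_nonneg F]
  have := mul_nonneg hp.le hn
  have h2 := sq_nonneg (a*B + b*A + (a*(-A-B) + c*A) + (b*(-A-B) + c*B) - 2*d*D - 2*e*E - 2*f*F)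
  linear_combination 4 * this + h2

/-- Concavity consequence: with `F(x) = f(x, u(x), Du(x))`,
`σ₂^{ij} (Δu)_{ij} ≥ ΔF − |DF|²/(2F)` on `B₁₀`. -/
theorem stmt_18 :
    ∀ K : ℝ, 1 ≤ K →
      ∀ (f : E3 × ℝ × E3 → ℝ) (u : E3 → ℝ), Hyp K f u →
        ∀ x ∈ ball (0 : E3) 10,
          ∑ i, ∑ j, sg u x i j * pd i (pd j (lap u)) x ≥
            lap (fun y => f (y, u y, grad u y)) x
              - ‖grad (fun y => f (y, u y, grad u y)) x‖ ^ 2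
                / (2 * f (x, u x, grad u x)) := by
  intro K hK f u ⟨_, hf, _, hu, heq, hlap, _⟩ x hx
  have hu : Sm u := hu
  have hfpos : 0 < f (x, u x, grad u x) := lt_of_lt_of_le (by positivity) (hf _)
  have hF : ∀ y ∈ ball (0 : E3) 10, f (y, u y, grad u y) =
      pd 0 (pd 0 u) y * pd 1 (pd 1 u) y + pd 0 (pd 0 u) y * pd 2 (pd 2 u) y
      + pd 1 (pd 1 u) y * pd 2 (pd 2 u) y - pd 0 (pd 1 u) y * pd 0 (pd 1 u) y
      - pd 0 (pd 2 u) y * pd 0 (pd 2 u) y - pd 1 (pd 2 u) y * pd 1 (pd 2 u) y := by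
    intro y hy
    rw [← heq y hy]
    simp only [sigma2, Matrix.trace, Matrix.diag, Matrix.mul_apply, hess, Matrix.of_apply,
      Fin.sum_univ_three]
    rw [pd_comm'_s18 hu 1 0 y hy, pd_comm'_s18 hu 2 0 y hy, pd_comm'_s18 hu 2 1 y hy]
    ring
  have hg : ∀ i j, Sm (pd i (pd j u)) := fun i j => (hu.pd j).pd i
  have hm : ∀ i j k l, Sm (fun y => pd i (pd j u) y * pd k (pd l u) y) :=
    fun i j k l => (hg i j).mul (hg k l)
  have s1 := (hm 0 0 1 1).add (hm 0 0 2 2)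
  have s2 := s1.add (hm 1 1 2 2)
  have s3 := s2.sub (hm 0 1 0 1)
  have s4 := s3.sub (hm 0 2 0 2)
  have hF1 : ∀ k, pd k (fun y => f (y, u y, grad u y)) x =
      (pd 0 (pd 0 u) x * pd k (pd 1 (pd 1 u)) x + pd 1 (pd 1 u) x * pd k (pd 0 (pd 0 u)) x)
      + (pd 0 (pd 0 u) x * pd k (pd 2 (pd 2 u)) x + pd 2 (pd 2 u) x * pd k (pd 0 (pd 0 u)) x)
      + (pd 1 (pd 1 u) x * pd k (pd 2 (pd 2 u)) x + pd 2 (pd 2 u) x * pd k (pd 1 (pd 1 u)) x)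
      - (pd 0 (pd 1 u) x * pd k (pd 0 (pd 1 u)) x + pd 0 (pd 1 u) x * pd k (pd 0 (pd 1 u)) x)
      - (pd 0 (pd 2 u) x * pd k (pd 0 (pd 2 u)) x + pd 0 (pd 2 u) x * pd k (pd 0 (pd 2 u)) x)
      - (pd 1 (pd 2 u) x * pd k (pd 1 (pd 2 u)) x + pd 1 (pd 2 u) x * pd k (pd 1 (pd 2 u)) x) := fun k => by
    rw [pd_congr' hF k x hx, pd_sub' s4 (hm 1 2 1 2) k x hx, pd_sub' s3 (hm 0 2 0 2) k x hx,
      pd_sub' s2 (hm 0 1 0 1) k x hx, pd_add' s1 (hm 1 1 2 2) k x hx,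
      pd_add' (hm 0 0 1 1) (hm 0 0 2 2) k x hx]
    simp only [pd_mul' (hg _ _) (hg _ _) k x hx]
  have hF2 : ∀ k, pd k (pd k (fun y => f (y, u y, grad u y))) x =
      (pd 0 (pd 0 u) x * pd k (pd k (pd 1 (pd 1 u))) x + 2 * (pd k (pd 0 (pd 0 u)) x * pd k (pd 1 (pd 1 u)) x)
        + pd 1 (pd 1 u) x * pd k (pd k (pd 0 (pd 0 u))) x)
      + (pd 0 (pd 0 u) x * pd k (pd k (pd 2 (pd 2 u))) x + 2 * (pd k (pd 0 (pd 0 u)) x * pd k (pd 2 (pd 2 u)) x)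
        + pd 2 (pd 2 u) x * pd k (pd k (pd 0 (pd 0 u))) x)
      + (pd 1 (pd 1 u) x * pd k (pd k (pd 2 (pd 2 u))) x + 2 * (pd k (pd 1 (pd 1 u)) x * pd k (pd 2 (pd 2 u)) x)
        + pd 2 (pd 2 u) x * pd k (pd k (pd 1 (pd 1 u))) x)
      - (pd 0 (pd 1 u) x * pd k (pd k (pd 0 (pd 1 u))) x + 2 * (pd k (pd 0 (pd 1 u)) x * pd k (pd 0 (pd 1 u)) x)
        + pd 0 (pd 1 u) x * pd k (pd k (pd 0 (pd 1 u))) x)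
      - (pd 0 (pd 2 u) x * pd k (pd k (pd 0 (pd 2 u))) x + 2 * (pd k (pd 0 (pd 2 u)) x * pd k (pd 0 (pd 2 u)) x)
        + pd 0 (pd 2 u) x * pd k (pd k (pd 0 (pd 2 u))) x)
      - (pd 1 (pd 2 u) x * pd k (pd k (pd 1 (pd 2 u))) x + 2 * (pd k (pd 1 (pd 2 u)) x * pd k (pd 1 (pd 2 u)) x)
        + pd 1 (pd 2 u) x * pd k (pd k (pd 1 (pd 2 u))) x) := fun k => by
    rw [pd_congr' (pd_congr' hF k) k x hx, pd2_sub s4 (hm 1 2 1 2) k k x hx,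
      pd2_sub s3 (hm 0 2 0 2) k k x hx,
      pd2_sub s2 (hm 0 1 0 1) k k x hx, pd2_add s1 (hm 1 1 2 2) k k x hx,
      pd2_add (hm 0 0 1 1) (hm 0 0 2 2) k k x hx]
    simp only [pd2_mul (hg _ _) (hg _ _) k x hx]
  have hL : ∀ i j, pd i (pd j (lap u)) x = pd 0 (pd 0 (pd i (pd j u))) x
      + pd 1 (pd 1 (pd i (pd j u))) x + pd 2 (pd 2 (pd i (pd j u))) x := by
    intro i j
    have : lap u = fun y => pd 0 (pd 0 u) y + pd 1 (pd 1 u) y + pd 2 (pd 2 u) y := by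
      funext y
      simp [lap, hess, Fin.sum_univ_three]
    rw [this, pd2_add ((hg 0 0).add (hg 1 1)) (hg 2 2) i j x hx,
      pd2_add (hg 0 0) (hg 1 1) i j x hx, pd4_comm hu i j 0 x hx, pd4_comm hu i j 1 x hx,
      pd4_comm hu i j 2 x hx]
  have hsym4 : ∀ k i j, pd k (pd k (pd i (pd j u))) x = pd k (pd k (pd j (pd i u))) x :=
    fun k i j => pd_congr' (pd_congr' (pd_comm'_s18 hu i j) k) k x hx
  have hlx : 0 < pd 0 (pd 0 u) x + pd 1 (pd 1 u) x + pd 2 (pd 2 u) x := by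
    have := hlap x hx
    simpa [lap, hess, Fin.sum_univ_three] using this
  have hG := fun k => garding _ _ _ _ _ _ (pd k (pd 0 (pd 0 u)) x) (pd k (pd 1 (pd 1 u)) x)
    (pd k (pd 2 (pd 2 u)) x) (pd k (pd 0 (pd 1 u)) x) (pd k (pd 0 (pd 2 u)) x)
    (pd k (pd 1 (pd 2 u)) x) hlx ((hF x hx) ▸ hfpos)
  simp only [← hF x hx, ← hF1] at hG
  have hn : ‖grad (fun y => f (y, u y, grad u y)) x‖ ^ 2 =
      pd 0 (fun y => f (y, u y, grad u y)) x ^ 2 + pd 1 (fun y => f (y, u y, grad u y)) x ^ 2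
      + pd 2 (fun y => f (y, u y, grad u y)) x ^ 2 := by
    rw [EuclideanSpace.real_norm_sq_eq, Fin.sum_univ_three]
    rfl
  have hl : lap (fun y => f (y, u y, grad u y)) x =
      pd 0 (pd 0 (fun y => f (y, u y, grad u y))) x + pd 1 (pd 1 (fun y => f (y, u y, grad u y))) x
      + pd 2 (pd 2 (fun y => f (y, u y, grad u y))) x := by
    simp [lap, hess, Fin.sum_univ_three]
  rw [hn, hl, add_div, add_div, hF2, hF2, hF2]
  have g0 := hG 0
  have g1 := hG 1
  have g2 := hG 2
  simp only [hL, sg, Fin.sum_univ_three, Matrix.sub_apply, Matrix.smul_apply, lap, hess,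
    Matrix.of_apply, Matrix.one_apply, smul_eq_mul]
  simp only [hsym4 _ 1 0, hsym4 _ 2 0, hsym4 _ 2 1, pd_comm'_s18 hu 1 0 x hx, pd_comm'_s18 hu 2 0 x hx,
    pd_comm'_s18 hu 2 1 x hx]
  simp only [Fin.isValue, Fin.reduceEq, if_true, if_false]
  linear_combination g0 + g1 + g2
end
end
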